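/- arXiv:1803.05583 — 4 statements merged into one kernel-verified Lean document; each statement's English description precedes it below -/
import Mathlib

section
/- Let S be a regular Nörlund summation method with weights σ_{n,k} = τ_n σ_{n−k}, τ_n = (Σ_{j=0}^n σ_j)^{−1}, and N_n = τ_n Σ_{k=0}^n 1/τ_k, and let the family (μ^(k)) be in the mean Nevai class M^(S)(Σ_{la,lb}). Then there exists a finite nonnegative Borel measure μ_Σ on ℝ such that for every bounded continuous function f : ℝ → ℝ both lim_{n→∞} Σ_{k=0}^n σ_{n,k} ∫_ℝ f(x) (p_k^(n−k)(x))² dμ^(n−k)(x) = ∫_ℝ f dμ_Σ and lim_{n→∞} (1/N_n) Σ_{k=0}^n σ_{n,k} ∫_ℝ f(x) K_k^(n−k)(x,x) dμ^(n−k)(x) = ∫_ℝ f dμ_Σ; that is, the weighted means λ_n of the Christoffel–Darboux kernels converge weakly to the same equilibrium measure μ_Σ as the mean measures μ̄_n. -/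
open Filter MeasureTheory

/-- The mean `∑ σ_{n,k} u_k^{(n-k)}` of a doubly indexed sequence along antidiagonals. -/
def weightedMean (σ u : ℕ → ℕ → ℝ) (n : ℕ) : ℝ :=
  ∑ k ∈ Finset.range (n + 1), σ n k * u (n - k) k

/-- Regular Nörlund weights. -/
structure IsNorlund (σ : ℕ → ℕ → ℝ) (σs τ : ℕ → ℝ) : Prop where
  sum_one : ∀ n, ∑ k ∈ Finset.range (n + 1), σ n k = 1
  tendsto_zero : ∀ k, Tendsto (fun n => σ n k) atTop (nhds 0)
  nonneg : ∀ j, 0 ≤ σs j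
  tau_eq : ∀ n, τ n = (∑ j ∈ Finset.range (n + 1), σs j)⁻¹
  tau_pos : ∀ n, 0 < τ n
  factor : ∀ n k, k ≤ n → σ n k = τ n * σs (n - k)

/-- The means of the absolute values of `u` tend to zero. -/
def IsMeanNull (σ u : ℕ → ℕ → ℝ) : Prop :=
  Tendsto (weightedMean σ fun j k => |u j k|) atTop (nhds 0)

/-- `u` is bounded and agrees up to a mean null sequence with a polynomial in the sequences `c i`. -/
def IsAsympPoly {ι : Type*} (σ : ℕ → ℕ → ℝ) (c : ι → ℕ → ℕ → ℝ) (u : ℕ → ℕ → ℝ) : Prop :=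
  (∃ C, ∀ j k, |u j k| ≤ C) ∧ ∃ P : MvPolynomial ι ℝ,
    IsMeanNull σ fun j k => u j k - MvPolynomial.eval (fun i => c i j k) P

lemma weightedMean_add (σ u v : ℕ → ℕ → ℝ) (n : ℕ) :
    weightedMean σ (fun j k => u j k + v j k) n = weightedMean σ u n + weightedMean σ v n := by
  simp [weightedMean, mul_add, Finset.sum_add_distrib]

lemma weightedMean_const_mul (σ u : ℕ → ℕ → ℝ) (C : ℝ) (n : ℕ) :
    weightedMean σ (fun j k => C * u j k) n = C * weightedMean σ u n := by
  simp only [weightedMean, Finset.mul_sum]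
  exact Finset.sum_congr rfl fun _ _ => by ring

section Norlund

variable {ι : Type*} {σ : ℕ → ℕ → ℝ} {σs τ : ℕ → ℝ} {c : ι → ℕ → ℕ → ℝ} {u v : ℕ → ℕ → ℝ}

lemma IsNorlund.weight_nonneg (h : IsNorlund σ σs τ) {n k : ℕ} (hk : k ≤ n) : 0 ≤ σ n k := by
  rw [h.factor n k hk]
  exact mul_nonneg (h.tau_pos n).le (h.nonneg _)

lemma IsNorlund.weightedMean_mono (h : IsNorlund σ σs τ) (huv : ∀ j k, u j k ≤ v j k) (n : ℕ) :
    weightedMean σ u n ≤ weightedMean σ v n :=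
  Finset.sum_le_sum fun _ hk => mul_le_mul_of_nonneg_left (huv _ _)
    (h.weight_nonneg (Nat.lt_succ_iff.1 (Finset.mem_range.1 hk)))

lemma IsNorlund.abs_weightedMean_le (h : IsNorlund σ σs τ) (n : ℕ) :
    |weightedMean σ u n| ≤ weightedMean σ (fun j k => |u j k|) n := by
  refine (Finset.abs_sum_le_sum_abs _ _).trans (Finset.sum_le_sum fun k hk => ?_)
  rw [abs_mul, abs_of_nonneg (h.weight_nonneg (Nat.lt_succ_iff.1 (Finset.mem_range.1 hk)))]

lemma IsNorlund.weightedMean_const (h : IsNorlund σ σs τ) (C : ℝ) (n : ℕ) :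
    weightedMean σ (fun _ _ => C) n = C := by
  simp [weightedMean, ← Finset.sum_mul, h.sum_one]

lemma IsNorlund.null_of_le (h : IsNorlund σ σs τ) (hv : IsMeanNull σ v)
    (huv : ∀ j k, |u j k| ≤ |v j k|) : IsMeanNull σ u :=
  squeeze_zero (fun n => (abs_nonneg _).trans (h.abs_weightedMean_le (u := u) n))
    (h.weightedMean_mono huv) hv

lemma IsNorlund.null_add (h : IsNorlund σ σs τ) (hu : IsMeanNull σ u) (hv : IsMeanNull σ v) :
    IsMeanNull σ fun j k => u j k + v j k := by
  have := Tendsto.add hu hv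
  rw [add_zero] at this
  refine squeeze_zero (fun n => (abs_nonneg _).trans (h.abs_weightedMean_le n)) (fun n => ?_) this
  rw [← weightedMean_add]
  exact h.weightedMean_mono (fun j k => abs_add_le _ _) n

lemma IsNorlund.null_mul (h : IsNorlund σ σs τ) (hu : IsMeanNull σ u)
    (hv : ∃ C, ∀ j k, |v j k| ≤ C) : IsMeanNull σ fun j k => v j k * u j k := by
  obtain ⟨C, hC⟩ := hv
  have := Tendsto.const_mul C hu
  rw [mul_zero] at this
  refine squeeze_zero (fun n => (abs_nonneg _).trans (h.abs_weightedMean_le n)) (fun n => ?_) this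
  rw [← weightedMean_const_mul]
  refine h.weightedMean_mono (fun j k => ?_) n
  rw [abs_mul]
  exact mul_le_mul_of_nonneg_right (hC j k) (abs_nonneg _)

lemma isMeanNull_zero : IsMeanNull σ fun _ _ => 0 := by
  have : weightedMean σ (fun _ _ => |(0 : ℝ)|) = fun _ => 0 := by
    ext
    simp [weightedMean]
  rw [IsMeanNull, this]
  exact tendsto_const_nhds

lemma IsNorlund.tau_succ_le (h : IsNorlund σ σs τ) (n : ℕ) : τ (n + 1) ≤ τ n := by
  have h1 := h.tau_pos n
  rw [h.tau_eq n] at h1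
  rw [h.tau_eq, h.tau_eq n, Finset.sum_range_succ _ (n + 1)]
  exact inv_anti₀ (inv_pos.1 h1) (le_add_of_nonneg_right (h.nonneg _))

lemma IsNorlund.null_shift (h : IsNorlund σ σs τ) (hu : IsMeanNull σ u)
    (hb : ∃ C, ∀ j k, |u j k| ≤ C) : IsMeanNull σ fun j k => u j (k - 1) := by
  obtain ⟨C, hC⟩ := hb
  have h0 : Tendsto (fun n => weightedMean σ (fun j k => |u j k|) n + σ (n + 1) 0 * C)
      atTop (nhds 0) := by
    simpa using Tendsto.add hu
      (((tendsto_add_atTop_iff_nat 1).2 (h.tendsto_zero 0)).mul_const C)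
  refine (tendsto_add_atTop_iff_nat 1).1 ?_
  refine squeeze_zero (fun n => (abs_nonneg _).trans (h.abs_weightedMean_le _)) (fun n => ?_) h0
  rw [weightedMean, Finset.sum_range_succ']
  refine add_le_add (Finset.sum_le_sum fun k hk => ?_)
    (mul_le_mul_of_nonneg_left (hC _ _) (h.weight_nonneg (Nat.zero_le _)))
  have hk' : k ≤ n := Nat.lt_succ_iff.1 (Finset.mem_range.1 hk)
  simp only [Nat.add_sub_add_right, Nat.add_sub_cancel]
  refine mul_le_mul_of_nonneg_right ?_ (abs_nonneg (u (n - k) k))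
  rw [h.factor _ _ (Nat.succ_le_succ hk'), h.factor _ _ hk', Nat.succ_sub_succ]
  exact mul_le_mul_of_nonneg_right (h.tau_succ_le n) (h.nonneg _)

lemma exists_bound_add (hu : ∃ C, ∀ j k, |u j k| ≤ C) (hv : ∃ C, ∀ j k, |v j k| ≤ C) :
    ∃ C, ∀ j k, |u j k + v j k| ≤ C := by
  obtain ⟨C, hC⟩ := hu
  obtain ⟨D, hD⟩ := hv
  exact ⟨C + D, fun j k => (abs_add_le _ _).trans (add_le_add (hC j k) (hD j k))⟩

lemma exists_bound_mul (hu : ∃ C, ∀ j k, |u j k| ≤ C) (hv : ∃ C, ∀ j k, |v j k| ≤ C) :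
    ∃ C, ∀ j k, |u j k * v j k| ≤ C := by
  obtain ⟨C, hC⟩ := hu
  obtain ⟨D, hD⟩ := hv
  refine ⟨C * D, fun j k => ?_⟩
  rw [abs_mul]
  exact mul_le_mul (hC j k) (hD j k) (abs_nonneg _) ((abs_nonneg _).trans (hC j k))

lemma exists_bound_eval (hc : ∀ i, ∃ C, ∀ j k, |c i j k| ≤ C) (P : MvPolynomial ι ℝ) :
    ∃ C, ∀ j k, |MvPolynomial.eval (fun i => c i j k) P| ≤ C := by
  induction P using MvPolynomial.induction_on with
  | C r => exact ⟨|r|, fun j k => by simp⟩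
  | add P Q hP hQ => simpa using exists_bound_add hP hQ
  | mul_X P i hP => simpa using exists_bound_mul hP (hc i)

lemma IsNorlund.null_eval_shift (h : IsNorlund σ σs τ) (hc : ∀ i, ∃ C, ∀ j k, |c i j k| ≤ C)
    (hs : ∀ i, IsMeanNull σ fun j k => c i j (k + 1) - c i j k) (P : MvPolynomial ι ℝ) :
    IsMeanNull σ fun j k => MvPolynomial.eval (fun i => c i j (k - 1)) P -
      MvPolynomial.eval (fun i => c i j k) P := by
  induction P using MvPolynomial.induction_on with
  | C r => simpa using isMeanNull_zero
  | add P Q hP hQ =>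
    convert h.null_add hP hQ using 3
    simp only [map_add]
    ring
  | mul_X P i hP =>
    have hi : IsMeanNull σ fun j k => c i j (k - 1) - c i j k := by
      obtain ⟨C, hC⟩ := hc i
      refine h.null_of_le (h.null_shift (hs i) ⟨C + C, fun j k =>
        (abs_sub _ _).trans (add_le_add (hC _ _) (hC _ _))⟩) fun j k => ?_
      cases k with
      | zero => simp
      | succ k => simp [abs_sub_comm]
    have hc' : ∃ C, ∀ j k, |c i j (k - 1)| ≤ C := (hc i).imp fun C hC j k => hC _ _
    convert h.null_add (h.null_mul hP hc') (h.null_mul hi (exists_bound_eval hc P)) using 3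
    simp only [map_mul, MvPolynomial.eval_X]
    ring

lemma isAsympPoly_const (r : ℝ) : IsAsympPoly σ c fun _ _ => r :=
  ⟨⟨|r|, fun _ _ => le_rfl⟩, MvPolynomial.C r, by simpa using isMeanNull_zero⟩

lemma IsNorlund.asympPoly_add (h : IsNorlund σ σs τ) (hu : IsAsympPoly σ c u)
    (hv : IsAsympPoly σ c v) : IsAsympPoly σ c fun j k => u j k + v j k := by
  obtain ⟨hub, P, hP⟩ := hu
  obtain ⟨hvb, Q, hQ⟩ := hv
  refine ⟨exists_bound_add hub hvb, P + Q, ?_⟩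
  convert h.null_add hP hQ using 3
  simp only [map_add]
  ring

lemma IsNorlund.asympPoly_mul (h : IsNorlund σ σs τ) (hc : ∀ i, ∃ C, ∀ j k, |c i j k| ≤ C)
    (hu : IsAsympPoly σ c u) (hv : IsAsympPoly σ c v) :
    IsAsympPoly σ c fun j k => u j k * v j k := by
  obtain ⟨hub, P, hP⟩ := hu
  obtain ⟨hvb, Q, hQ⟩ := hv
  refine ⟨exists_bound_mul hub hvb, P * Q, ?_⟩
  convert h.null_add (h.null_mul hP hvb) (h.null_mul hQ (exists_bound_eval hc P)) using 3
  simp only [map_mul]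
  ring

lemma IsNorlund.asympPoly_shift (h : IsNorlund σ σs τ) (hc : ∀ i, ∃ C, ∀ j k, |c i j k| ≤ C)
    (hs : ∀ i, IsMeanNull σ fun j k => c i j (k + 1) - c i j k) (hu : IsAsympPoly σ c u) :
    IsAsympPoly σ c fun j k => u j (k - 1) := by
  obtain ⟨hub, P, hP⟩ := hu
  refine ⟨hub.imp fun C hC j k => hC _ _, P, ?_⟩
  have hb := exists_bound_add hub (exists_bound_mul
    (u := fun _ _ => -1) ⟨1, fun _ _ => by simp⟩ (exists_bound_eval hc P))
  convert h.null_add (h.null_shift hP (by simpa [sub_eq_add_neg] using hb))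
    (h.null_eval_shift hc hs P) using 3
  ring

lemma isAsympPoly_generator
    (hc : ∀ i, ∃ C, ∀ j k, |c i j k| ≤ C)
    (hs : ∀ i l, 1 ≤ l → IsMeanNull σ fun j k => c i j (k + l) - c i j k) (i : ι) (l : ℕ) :
    IsAsympPoly σ c fun j k => c i j (k + l) := by
  refine ⟨(hc i).imp fun C hC j k => hC _ _, MvPolynomial.X i, ?_⟩
  simp only [MvPolynomial.eval_X]
  rcases Nat.eq_zero_or_pos l with rfl | hl
  · simpa using isMeanNull_zero
  · exact hs i l hl

lemma IsNorlund.exists_tendsto_of_asympPoly (h : IsNorlund σ σs τ)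
    (hm : ∀ s : ι →₀ ℕ, ∃ L, Tendsto
      (weightedMean σ fun j k => s.prod fun i e => c i j k ^ e) atTop (nhds L))
    (hu : IsAsympPoly σ c u) : ∃ L, Tendsto (weightedMean σ u) atTop (nhds L) := by
  obtain ⟨-, P, hP⟩ := hu
  have key : ∃ L, Tendsto (weightedMean σ fun j k => MvPolynomial.eval (fun i => c i j k) P)
      atTop (nhds L) := by
    clear hP
    induction P using MvPolynomial.induction_on' with
    | monomial s r =>
      obtain ⟨L, hL⟩ := hm s
      refine ⟨r * L, (hL.const_mul r).congr fun n => ?_⟩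
      rw [← weightedMean_const_mul]
      simp [MvPolynomial.eval_monomial]
    | add P Q hP hQ =>
      obtain ⟨L, hL⟩ := hP
      obtain ⟨M, hM⟩ := hQ
      refine ⟨L + M, (hL.add hM).congr fun n => ?_⟩
      rw [← weightedMean_add]
      simp
  obtain ⟨L, hL⟩ := key
  have h0 := squeeze_zero_norm (f := weightedMean σ fun j k =>
    u j k - MvPolynomial.eval (fun i => c i j k) P) h.abs_weightedMean_le hP
  refine ⟨0 + L, (h0.add hL).congr fun n => ?_⟩
  rw [← weightedMean_add]
  simp

/-- Symmetric moments obeying a three-term recurrence with coefficients `c false`, `c true`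
are asymptotically polynomial in the coefficients. -/
lemma IsNorlund.asympPoly_of_recurrence (h : IsNorlund σ σs τ) {c : Bool → ℕ → ℕ → ℝ}
    (hc : ∀ i, ∃ C, ∀ j k, |c i j k| ≤ C)
    (hs : ∀ i l, 1 ≤ l → IsMeanNull σ fun j k => c i j (k + l) - c i j k)
    (hc0 : ∀ j, c true j 0 = 0) {J : ℕ → ℕ → ℕ → ℕ → ℝ}
    (hJ0 : ∀ j k l, J 0 j k l = if k = l then 1 else 0) (hJsymm : ∀ m j k l, J m j k l = J m j l k)
    (hJ : ∀ m j k l, J (m + 1) j k l = c true j (l + 1) * J m j k (l + 1) +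
      c false j l * J m j k l + c true j l * J m j k (l - 1)) (m s : ℕ) :
    IsAsympPoly σ c fun j k => J m j k (k + s) := by
  have hgen := isAsympPoly_generator hc hs
  induction m generalizing s with
  | zero =>
    simp only [hJ0]
    cases s with
    | zero => simpa using isAsympPoly_const 1
    | succ s => simpa using isAsympPoly_const 0
  | succ m ih =>
    simp only [hJ]
    refine h.asympPoly_add (h.asympPoly_add ?_ (h.asympPoly_mul hc (hgen _ _) (ih s))) ?_
    · simpa only [add_assoc] using h.asympPoly_mul hc (hgen true (s + 1)) (ih (s + 1))
    cases s with
    | zero =>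
      convert h.asympPoly_mul hc (hgen true 0)
        (h.asympPoly_shift hc (fun i => hs i 1 le_rfl) (ih 1)) using 3 with j k
      cases k with
      | zero => simp [hc0]
      | succ k => simp [hJsymm m j (k + 1) k]
    | succ s => exact h.asympPoly_mul hc (hgen true (s + 1)) (ih s)

/-- Partial sums along the second index, averaged and normalised, have the same limit. -/
lemma IsNorlund.tendsto_mean_partialSum (h : IsNorlund σ σs τ) {N : ℕ → ℝ}
    (hN : ∀ n, N n = τ n * ∑ k ∈ Finset.range (n + 1), (τ k)⁻¹) {L : ℝ}
    (hu : Tendsto (weightedMean σ u) atTop (nhds L)) :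
    Tendsto (fun n => 1 / N n *
      weightedMean σ (fun j k => ∑ l ∈ Finset.range (k + 1), u j l) n) atTop (nhds L) := by
  have hpos : ∀ n, 0 < (τ n)⁻¹ := fun n => inv_pos.2 (h.tau_pos n)
  have hge : ∀ n, (τ 0)⁻¹ ≤ (τ n)⁻¹ := fun n =>
    inv_anti₀ (h.tau_pos n) (antitone_nat_of_succ_le h.tau_succ_le (Nat.zero_le n))
  have hdiv : Tendsto (fun n => ∑ k ∈ Finset.range n, (τ k)⁻¹) atTop atTop := by
    refine tendsto_atTop_mono (fun n => ?_)
      (tendsto_natCast_atTop_atTop.atTop_mul_const (hpos 0))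
    simpa using Finset.sum_le_sum (s := Finset.range n) fun k _ => hge k
  have ho : (fun n => (τ n)⁻¹ * (weightedMean σ u n - L)) =o[atTop] fun n => (τ n)⁻¹ := by
    have := (Asymptotics.isBigO_refl (fun n => (τ n)⁻¹) atTop).mul_isLittleO
      ((Asymptotics.isLittleO_one_iff ℝ).2 (tendsto_sub_nhds_zero_iff.2 hu))
    simpa using this
  have hlim := ((tendsto_add_atTop_iff_nat 1).2
    (ho.sum_range (fun n => (hpos n).le) hdiv).tendsto_div_nhds_zero).add_const L
  rw [zero_add] at hlim
  refine hlim.congr fun n => ?_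
  have hS : 0 < ∑ k ∈ Finset.range (n + 1), (τ k)⁻¹ :=
    Finset.sum_pos (fun k _ => hpos k) ⟨0, by simp⟩
  have hsum : weightedMean σ (fun j k => ∑ l ∈ Finset.range (k + 1), u j l) n =
      τ n * ∑ i ∈ Finset.range (n + 1), (τ i)⁻¹ * weightedMean σ u i := by
    have e1 : ∀ i, (τ i)⁻¹ * weightedMean σ u i =
        ∑ l ∈ Finset.range (i + 1), σs (i - l) * u (i - l) l := fun i => by
      rw [weightedMean, Finset.mul_sum]
      refine Finset.sum_congr rfl fun k hk => ?_
      rw [h.factor _ _ (Nat.lt_succ_iff.1 (Finset.mem_range.1 hk)), mul_assoc,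
        inv_mul_cancel_left₀ (h.tau_pos i).ne']
    simp only [e1]
    rw [weightedMean, Finset.mul_sum]
    have e2 : ∀ k ∈ Finset.range (n + 1),
        σ n k * ∑ l ∈ Finset.range (k + 1), u (n - k) l =
        τ n * ∑ l ∈ Finset.range (k + 1), σs (n - k) * u (n - k) l := fun k hk => by
      rw [h.factor _ _ (Nat.lt_succ_iff.1 (Finset.mem_range.1 hk)), mul_assoc, Finset.mul_sum]
    rw [Finset.sum_congr rfl e2, ← Finset.mul_sum, ← Finset.mul_sum]
    congr 1
    rw [Finset.sum_sigma', Finset.sum_sigma']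
    refine Finset.sum_bij' (fun x _ => ⟨n - x.1 + x.2, x.2⟩) (fun x _ => ⟨n - (x.1 - x.2), x.2⟩)
      ?_ ?_ ?_ ?_ ?_
    all_goals
      rintro ⟨k, l⟩ hx
      simp only [Finset.mem_sigma, Finset.mem_range, Sigma.mk.injEq, heq_eq_eq, and_true] at hx ⊢
    · omega
    · omega
    · omega
    · omega
    · simp
  rw [hsum, hN]
  have h1 : ∑ i ∈ Finset.range (n + 1), (τ i)⁻¹ * (weightedMean σ u i - L) =
      ∑ i ∈ Finset.range (n + 1), (τ i)⁻¹ * weightedMean σ u i -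
        (∑ i ∈ Finset.range (n + 1), (τ i)⁻¹) * L := by
    rw [Finset.sum_mul, ← Finset.sum_sub_distrib]
    exact Finset.sum_congr rfl fun _ _ => mul_sub _ _ _
  have := (h.tau_pos n).ne'
  rw [h1]
  generalize ∑ k ∈ Finset.range (n + 1), (τ k)⁻¹ = S at hS ⊢
  field_simp
  ring

end Norlund

lemma integrable_of_continuous_of_support {ν : Measure ℝ} [IsFiniteMeasure ν] {R : ℝ}
    (hR : ν (Set.Icc (-R) R)ᶜ = 0) {f : ℝ → ℝ} (hf : Continuous f) : Integrable f ν := by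
  have : ν.restrict (Set.Icc (-R) R) = ν :=
    Measure.restrict_eq_self_of_ae_mem (mem_ae_iff.2 hR)
  rw [← this]
  exact hf.integrableOn_Icc

section Weak

variable {σ : ℕ → ℕ → ℝ} {σs τ : ℕ → ℝ}

/-- Convergence of mean moments implies convergence of the means of continuous functions, for
probability measures with a common bounded support. -/
lemma IsNorlund.exists_tendsto_integral (h : IsNorlund σ σs τ) {ρ : ℕ → ℕ → Measure ℝ}
    [∀ j k, IsProbabilityMeasure (ρ j k)] {R : ℝ} (hR : ∀ j k, ρ j k (Set.Icc (-R) R)ᶜ = 0)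
    (hm : ∀ m : ℕ, ∃ L, Tendsto (weightedMean σ fun j k => ∫ x, x ^ m ∂ρ j k) atTop (nhds L))
    {f : ℝ → ℝ} (hf : Continuous f) :
    ∃ L, Tendsto (weightedMean σ fun j k => ∫ x, f x ∂ρ j k) atTop (nhds L) := by
  have hint : ∀ j k {g : ℝ → ℝ}, Continuous g → Integrable g (ρ j k) :=
    fun j k g hg => integrable_of_continuous_of_support (hR j k) hg
  have hpoly : ∀ q : Polynomial ℝ,
      ∃ L, Tendsto (weightedMean σ fun j k => ∫ x, q.eval x ∂ρ j k) atTop (nhds L) := by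
    intro q
    induction q using Polynomial.induction_on' with
    | add P Q hP hQ =>
      obtain ⟨L, hL⟩ := hP
      obtain ⟨M, hM⟩ := hQ
      refine ⟨L + M, (hL.add hM).congr fun n => ?_⟩
      rw [← weightedMean_add]
      simp only [Polynomial.eval_add]
      congr 1
      ext j k
      rw [integral_add (hint j k P.continuous) (hint j k Q.continuous)]
    | monomial m r =>
      obtain ⟨L, hL⟩ := hm m
      refine ⟨r * L, (hL.const_mul r).congr fun n => ?_⟩
      rw [← weightedMean_const_mul]
      simp only [Polynomial.eval_monomial, integral_const_mul]
  refine cauchySeq_tendsto_of_complete (Metric.cauchySeq_iff.2 fun ε hε => ?_)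
  obtain ⟨q, hq⟩ := exists_polynomial_near_of_continuousOn (-R) R f hf.continuousOn (ε / 3)
    (by positivity)
  have hclose : ∀ n, |weightedMean σ (fun j k => ∫ x, f x ∂ρ j k) n -
      weightedMean σ (fun j k => ∫ x, q.eval x ∂ρ j k) n| ≤ ε / 3 := by
    intro n
    have e : weightedMean σ (fun j k => ∫ x, f x ∂ρ j k) n -
        weightedMean σ (fun j k => ∫ x, q.eval x ∂ρ j k) n =
        weightedMean σ (fun j k => ∫ x, f x - q.eval x ∂ρ j k) n := by
      rw [sub_eq_iff_eq_add, ← weightedMean_add]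
      congr 1
      ext j k
      rw [integral_sub (hint j k hf) (hint j k q.continuous), sub_add_cancel]
    rw [e]
    refine (h.abs_weightedMean_le n).trans ?_
    rw [← h.weightedMean_const (ε / 3) n]
    refine h.weightedMean_mono (fun j k => ?_) n
    have hae : ∀ᵐ x ∂ρ j k, ‖f x - q.eval x‖ ≤ ε / 3 := by
      have : ∀ᵐ x ∂ρ j k, x ∈ Set.Icc (-R) R := mem_ae_iff.2 (hR j k)
      filter_upwards [this] with x hx
      rw [Real.norm_eq_abs, abs_sub_comm]
      exact (hq x hx).le
    simpa using norm_integral_le_of_norm_le_const hae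
  obtain ⟨L, hL⟩ := hpoly q
  obtain ⟨n₀, hn₀⟩ := Metric.cauchySeq_iff.1 hL.cauchySeq (ε / 3) (by positivity)
  refine ⟨n₀, fun m hm n hn => ?_⟩
  have h1 := abs_le.1 (hclose m)
  have h2 := abs_le.1 (hclose n)
  have h3 := abs_lt.1 (hn₀ m hm n hn)
  rw [Real.dist_eq, abs_lt]
  constructor <;> linarith [h1.1, h1.2, h2.1, h2.2, h3.1, h3.2]

/-- Convergence of mean moments implies weak convergence of the mean measures. -/
lemma IsNorlund.exists_weak_limit (h : IsNorlund σ σs τ) {ρ : ℕ → ℕ → Measure ℝ}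
    [∀ j k, IsProbabilityMeasure (ρ j k)] {R : ℝ} (hR : ∀ j k, ρ j k (Set.Icc (-R) R)ᶜ = 0)
    (hm : ∀ m : ℕ, ∃ L, Tendsto (weightedMean σ fun j k => ∫ x, x ^ m ∂ρ j k) atTop (nhds L)) :
    ∃ μS : Measure ℝ, IsFiniteMeasure μS ∧ ∀ f : ℝ → ℝ, Continuous f → (∃ C, ∀ x, |f x| ≤ C) →
      Tendsto (weightedMean σ fun j k => ∫ x, f x ∂ρ j k) atTop (nhds (∫ x, f x ∂μS)) := by
  let ν : ℕ → Measure ℝ := fun n =>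
    ∑ k ∈ Finset.range (n + 1), ENNReal.ofReal (σ n k) • ρ (n - k) k
  have hw : ∀ n, ∀ k ∈ Finset.range (n + 1), 0 ≤ σ n k := fun n k hk =>
    h.weight_nonneg (Nat.lt_succ_iff.1 (Finset.mem_range.1 hk))
  have hprob : ∀ n, IsProbabilityMeasure (ν n) := fun n => ⟨by
    simp only [ν, Measure.coe_finsetSum, Finset.sum_apply, Measure.smul_apply, measure_univ,
      smul_eq_mul, mul_one]
    rw [← ENNReal.ofReal_sum_of_nonneg (hw n), h.sum_one, ENNReal.ofReal_one]⟩
  have hνR : ∀ n, ν n (Set.Icc (-R) R)ᶜ = 0 := fun n => by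
    simp [ν, hR]
  have hνint : ∀ n {f : ℝ → ℝ}, Continuous f →
      ∫ x, f x ∂ν n = weightedMean σ (fun j k => ∫ x, f x ∂ρ j k) n := by
    intro n f hf
    rw [integral_finsetSum_measure fun k _ =>
      (integrable_of_continuous_of_support (hR _ _) hf).smul_measure ENNReal.ofReal_ne_top]
    refine Finset.sum_congr rfl fun k hk => ?_
    rw [integral_smul_measure, ENNReal.toReal_ofReal (hw n k hk), smul_eq_mul]
  let P : ℕ → ProbabilityMeasure ℝ := fun n => ⟨ν n, hprob n⟩
  have htight : IsTightMeasureSet {((x : ProbabilityMeasure ℝ) : Measure ℝ) | x ∈ Set.range P} := by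
    rw [isTightMeasureSet_iff_exists_isCompact_measure_compl_le]
    refine fun ε _ => ⟨Set.Icc (-R) R, isCompact_Icc, ?_⟩
    rintro _ ⟨_, ⟨n, rfl⟩, rfl⟩
    exact (hνR n).le.trans zero_le
  obtain ⟨μS, -, hμS⟩ := (isCompact_closure_of_isTightMeasureSet htight).ultrafilter_le_nhds
    ((hyperfilter ℕ : Ultrafilter ℕ).map P) (by
      rw [le_principal_iff]
      exact Ultrafilter.mem_map.2 (Filter.univ_mem' fun n => subset_closure ⟨n, rfl⟩))
  refine ⟨μS, inferInstance, fun f hf ⟨C, hC⟩ => ?_⟩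
  obtain ⟨L, hL⟩ := h.exists_tendsto_integral hR hm hf
  let F : BoundedContinuousFunction ℝ ℝ := BoundedContinuousFunction.ofNormedAddCommGroup f hf C hC
  have h1 : Tendsto (fun n => ∫ x, f x ∂ν n) (hyperfilter ℕ) (nhds (∫ x, f x ∂(μS : Measure ℝ))) :=
    ProbabilityMeasure.tendsto_iff_forall_integral_tendsto.1
      (show Tendsto P (hyperfilter ℕ) (nhds μS) from hμS) F
  simp only [fun n => hνint n hf] at h1
  rwa [tendsto_nhds_unique h1 (hL.mono_left Nat.hyperfilter_le_atTop)]

end Weak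

theorem stmt6
    (μ : ℕ → MeasureTheory.Measure ℝ)
    (hfin : ∀ k, MeasureTheory.IsFiniteMeasure (μ k))
    (hsupp : ∃ R : ℝ, ∀ k, μ k ((Set.Icc (-R) R)ᶜ) = 0)
    (p : ℕ → ℕ → Polynomial ℝ) (ca cb : ℕ → ℕ → ℝ)
    (hdeg : ∀ k l, (p k l).natDegree = l)
    (hlead : ∀ k l, 0 < (p k l).leadingCoeff)
    (horth : ∀ k l m, (∫ x, (p k l).eval x * (p k m).eval x ∂ (μ k)) = if l = m then 1 else 0)
    (hb0 : ∀ k, cb k 0 = 0)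
    (hbpos : ∀ k l, 0 < cb k (l+1))
    (hrec : ∀ k l, Polynomial.X * p k l =
      Polynomial.C (cb k (l+1)) * p k (l+1) + Polynomial.C (ca k l) * p k l +
      Polynomial.C (cb k l) * p k (l-1))
    (σ : ℕ → ℕ → ℝ)
    (hσ0 : ∀ n k, k ≤ n → 0 ≤ σ n k)
    (hσ1 : ∀ n, ∑ k ∈ Finset.range (n+1), σ n k = 1)
    (hσ2 : ∀ k, Filter.Tendsto (fun n => σ n k) Filter.atTop (nhds 0))
    (σs : ℕ → ℝ) (hσs : ∀ j, 0 ≤ σs j)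
    (τ : ℕ → ℝ) (hτ : ∀ n, τ n = (∑ j ∈ Finset.range (n+1), σs j)⁻¹)
    (hτpos : ∀ n, 0 < τ n)
    (hfac : ∀ n k, k ≤ n → σ n k = τ n * σs (n-k))
    (N : ℕ → ℝ) (hN : ∀ n, N n = τ n * ∑ k ∈ Finset.range (n+1), (τ k)⁻¹)
    (Slim : ℕ → ℕ → ℝ)
    (hbdA : ∃ A : ℝ, ∀ k n, |ca k n| ≤ A)
    (hbdB : ∃ B : ℝ, ∀ k n, cb k n ≤ B)
    (hNa : ∀ l : ℕ, 1 ≤ l → Filter.Tendsto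
      (fun n => ∑ k ∈ Finset.range (n+1), σ n k * |ca (n-k) (k+l) - ca (n-k) k|)
      Filter.atTop (nhds 0))
    (hNb : ∀ l : ℕ, 1 ≤ l → Filter.Tendsto
      (fun n => ∑ k ∈ Finset.range (n+1), σ n k * |cb (n-k) (k+l) - cb (n-k) k|)
      Filter.atTop (nhds 0))
    (hNs : ∀ la lb : ℕ, Filter.Tendsto
      (fun n => ∑ k ∈ Finset.range (n+1), σ n k * (ca (n-k) k)^la * (cb (n-k) k)^lb)
      Filter.atTop (nhds (Slim la lb)))
    :
    ∃ μS : MeasureTheory.Measure ℝ, MeasureTheory.IsFiniteMeasure μS ∧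
      (∀ f : ℝ → ℝ, Continuous f → (∃ C : ℝ, ∀ x, |f x| ≤ C) →
        (Filter.Tendsto (fun n => ∑ k ∈ Finset.range (n+1),
          σ n k * ∫ x, f x * ((p (n-k) k).eval x)^2 ∂ (μ (n-k)))
          Filter.atTop (nhds (∫ x, f x ∂ μS))) ∧
        (Filter.Tendsto (fun n => (1 / N n) * ∑ k ∈ Finset.range (n+1),
          σ n k * ∫ x, f x * (∑ l ∈ Finset.range (k+1), ((p (n-k) l).eval x)^2) ∂ (μ (n-k)))
          Filter.atTop (nhds (∫ x, f x ∂ μS)))) := by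
  obtain ⟨R, hR⟩ := hsupp
  have h : IsNorlund σ σs τ := ⟨hσ1, hσ2, hσs, hτ, hτpos, hfac⟩
  have hint : ∀ j {g : ℝ → ℝ}, Continuous g → Integrable g (μ j) :=
    fun j g hg => integrable_of_continuous_of_support (hR j) hg
  let ρ : ℕ → ℕ → Measure ℝ := fun j k =>
    (μ j).withDensity fun x => ENNReal.ofReal ((p j k).eval x ^ 2)
  have hsq : ∀ j k, Continuous fun x => (p j k).eval x ^ 2 := fun j k =>
    (p j k).continuous.pow 2
  have hρint : ∀ j k (g : ℝ → ℝ), ∫ x, g x ∂ρ j k = ∫ x, g x * (p j k).eval x ^ 2 ∂μ j := by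
    intro j k g
    rw [integral_withDensity_eq_integral_toReal_smul
      (hsq j k).measurable.ennreal_ofReal (by simp)]
    refine integral_congr_ae (.of_forall fun x => ?_)
    simp [ENNReal.toReal_ofReal (sq_nonneg ((p j k).eval x)), mul_comm]
  have hρprob : ∀ j k, IsProbabilityMeasure (ρ j k) := fun j k => ⟨by
    rw [withDensity_apply _ MeasurableSet.univ, Measure.restrict_univ,
      ← ofReal_integral_eq_lintegral_ofReal (hint j (hsq j k))
        (.of_forall fun x => sq_nonneg _)]
    simpa [pow_two] using horth j k k⟩
  have hρR : ∀ j k, ρ j k (Set.Icc (-R) R)ᶜ = 0 := fun j k =>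
    withDensity_absolutelyContinuous _ _ (hR j)
  let c : Bool → ℕ → ℕ → ℝ := fun i => cond i cb ca
  have hc : ∀ i, ∃ C, ∀ j k, |c i j k| ≤ C := by
    rintro (_ | _)
    · exact hbdA
    · obtain ⟨B, hB⟩ := hbdB
      refine ⟨B, fun j k => ?_⟩
      have : 0 ≤ cb j k := by
        cases k with
        | zero => exact (hb0 j).ge
        | succ k => exact (hbpos j k).le
      exact (abs_of_nonneg this).trans_le (hB j k)
  have hs : ∀ i l, 1 ≤ l → IsMeanNull σ fun j k => c i j (k + l) - c i j k := by
    rintro (_ | _) l hl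
    · exact hNa l hl
    · exact hNb l hl
  have hmono : ∀ s : Bool →₀ ℕ, ∃ L, Tendsto
      (weightedMean σ fun j k => s.prod fun i e => c i j k ^ e) atTop (nhds L) := by
    refine fun s => ⟨Slim (s false) (s true), (hNs (s false) (s true)).congr fun n => ?_⟩
    refine Finset.sum_congr rfl fun k _ => ?_
    simp only [Finsupp.prod_fintype _ _ fun _ => pow_zero _, Fintype.prod_bool, c, cond]
    ring
  let J : ℕ → ℕ → ℕ → ℕ → ℝ := fun m j k l =>
    ∫ x, x ^ m * ((p j k).eval x * (p j l).eval x) ∂μ j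
  have hJcont : ∀ m j k l,
      Continuous fun x : ℝ => x ^ m * ((p j k).eval x * (p j l).eval x) := fun m j k l =>
    (continuous_pow m).mul ((p j k).continuous.mul (p j l).continuous)
  have hJ : ∀ m j k l, J (m + 1) j k l = c true j (l + 1) * J m j k (l + 1) +
      c false j l * J m j k l + c true j l * J m j k (l - 1) := by
    intro m j k l
    simp only [J]
    have hi : ∀ l (r : ℝ), Integrable
        (fun x => r * (x ^ m * ((p j k).eval x * (p j l).eval x))) (μ j) := fun l r =>
      (hint j (hJcont m j k l)).const_mul r
    rw [← integral_const_mul, ← integral_const_mul, ← integral_const_mul,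
      ← integral_add (hi _ _) (hi _ _), ← integral_add (by exact (hi _ _).add (hi _ _)) (hi _ _)]
    refine integral_congr_ae (.of_forall fun x => ?_)
    have hx := congrArg (Polynomial.eval x) (hrec j l)
    simp only [Polynomial.eval_mul, Polynomial.eval_add, Polynomial.eval_X,
      Polynomial.eval_C] at hx
    simp only [c, cond]
    linear_combination x ^ m * (p j k).eval x * hx
  have hJasymp := h.asympPoly_of_recurrence hc hs (J := J) hb0 (fun j k l => by simp [J, horth])
    (fun m j k l => by simp only [J, mul_comm]) hJ
  have hm : ∀ m : ℕ, ∃ L, Tendsto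
      (weightedMean σ fun j k => ∫ x, x ^ m ∂ρ j k) atTop (nhds L) := by
    intro m
    obtain ⟨L, hL⟩ := h.exists_tendsto_of_asympPoly hmono (hJasymp m 0)
    refine ⟨L, hL.congr fun n => ?_⟩
    simp only [J, hρint, add_zero, pow_two]
  obtain ⟨μS, hμS, hlim⟩ := h.exists_weak_limit hρR hm
  refine ⟨μS, hμS, fun f hf hfb => ?_⟩
  have h1 := hlim f hf hfb
  simp only [hρint] at h1
  refine ⟨h1, (h.tendsto_mean_partialSum hN h1).congr fun n => ?_⟩
  congr 1
  refine Finset.sum_congr rfl fun k _ => ?_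
  simp only [Finset.mul_sum]
  rw [integral_finsetSum _ fun l _ => hint _ (by exact hf.mul (hsq _ _)),
    Finset.mul_sum]
end

section
/- Let S be a regular Nörlund summation method with weights σ_{n,k} = τ_n σ_{n−k}, τ_n = (Σ_{j=0}^n σ_j)^{−1}, and N_n = τ_n Σ_{k=0}^n 1/τ_k, and assume N_n → ∞. Let the family (μ^(k)) be in the mean Nevai class M^(S)(Σ_{la,lb}). Then there exists a finite nonnegative Borel measure μ_Σ on ℝ such that for every bounded continuous function f : ℝ → ℝ both lim_{n→∞} Σ_{k=0}^n σ_{n,k} ∫_ℝ f(x) (p_k^(n−k)(x))² dμ^(n−k)(x) = ∫_ℝ f dμ_Σ and lim_{n→∞} (1/N_n) Σ_{k=0}^n σ_{n,k} Σ_{j=1}^{k+1} f(x_{k+1,j}^(n−k)) = ∫_ℝ f dμ_Σ, where x_{k+1,1}^(n−k), …, x_{k+1,k+1}^(n−k) are the (real, simple) roots of the orthonormal polynomial p_{k+1}^(n−k); that is, the mean root-counting measures ν_{n+1} converge weakly to the same equilibrium measure μ_Σ as the mean measures μ̄_n. -/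
open Filter MeasureTheory

/-- The Nörlund mean with weights `s` of a double array along its `n`-th antidiagonal. -/
noncomputable def norlundMean (s : ℕ → ℝ) (u : ℕ → ℕ → ℝ) (n : ℕ) : ℝ :=
  (∑ j ∈ Finset.range (n + 1), s j)⁻¹ * ∑ k ∈ Finset.range (n + 1), s (n - k) * u (n - k) k

/-- Regular nonnegative Nörlund weights. -/
structure RegularWeights (s : ℕ → ℝ) : Prop where
  nonneg : ∀ j, 0 ≤ s j
  pos : ∀ n, 0 < ∑ j ∈ Finset.range (n + 1), s j
  tendsto : Tendsto (fun n => s n / ∑ j ∈ Finset.range (n + 1), s j) atTop (nhds 0)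

/-- Uniformly bounded double arrays. -/
def ArrayBounded (u : ℕ → ℕ → ℝ) : Prop := ∃ C, ∀ j k, |u j k| ≤ C

/-- Double arrays whose absolute value has vanishing Nörlund means. -/
def MeanNull (s : ℕ → ℝ) (u : ℕ → ℕ → ℝ) : Prop :=
  Tendsto (norlundMean s fun j k => |u j k|) atTop (nhds 0)

namespace ArrayBounded

variable {u v : ℕ → ℕ → ℝ}

theorem add (hu : ArrayBounded u) (hv : ArrayBounded v) :
    ArrayBounded (fun j k => u j k + v j k) := by
  obtain ⟨C, hC⟩ := hu
  obtain ⟨D, hD⟩ := hv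
  exact ⟨C + D, fun j k => (abs_add_le _ _).trans (add_le_add (hC j k) (hD j k))⟩

theorem mul (hu : ArrayBounded u) (hv : ArrayBounded v) :
    ArrayBounded (fun j k => u j k * v j k) := by
  obtain ⟨C, hC⟩ := hu
  obtain ⟨D, hD⟩ := hv
  refine ⟨C * D, fun j k => ?_⟩
  rw [abs_mul]
  exact mul_le_mul (hC j k) (hD j k) (abs_nonneg _) ((abs_nonneg _).trans (hC j k))

theorem pow (hu : ArrayBounded u) (m : ℕ) : ArrayBounded (fun j k => u j k ^ m) := by
  obtain ⟨C, hC⟩ := hu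
  refine ⟨C ^ m, fun j k => ?_⟩
  rw [abs_pow]
  exact pow_le_pow_left₀ (abs_nonneg _) (hC j k) m

end ArrayBounded

section NorlundMean

variable {s : ℕ → ℝ} {u v : ℕ → ℕ → ℝ}

theorem norlundMean_add (s : ℕ → ℝ) (u v : ℕ → ℕ → ℝ) (n : ℕ) :
    norlundMean s (fun j k => u j k + v j k) n = norlundMean s u n + norlundMean s v n := by
  simp only [norlundMean, mul_add, Finset.sum_add_distrib]

theorem norlundMean_const_mul (s : ℕ → ℝ) (c : ℝ) (u : ℕ → ℕ → ℝ) (n : ℕ) :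
    norlundMean s (fun j k => c * u j k) n = c * norlundMean s u n := by
  simp only [norlundMean, mul_left_comm _ c, ← Finset.mul_sum]

theorem RegularWeights.mean_mono (hs : RegularWeights s) (h : ∀ j k, u j k ≤ v j k) (n : ℕ) :
    norlundMean s u n ≤ norlundMean s v n :=
  mul_le_mul_of_nonneg_left
    (Finset.sum_le_sum fun _ _ => mul_le_mul_of_nonneg_left (h _ _) (hs.nonneg _))
    (inv_nonneg.2 (hs.pos n).le)

theorem RegularWeights.mean_nonneg (hs : RegularWeights s) (h : ∀ j k, 0 ≤ u j k) (n : ℕ) :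
    0 ≤ norlundMean s u n :=
  mul_nonneg (inv_nonneg.2 (hs.pos n).le)
    (Finset.sum_nonneg fun _ _ => mul_nonneg (hs.nonneg _) (h _ _))

theorem RegularWeights.abs_mean_le (hs : RegularWeights s) (u : ℕ → ℕ → ℝ) (n : ℕ) :
    |norlundMean s u n| ≤ norlundMean s (fun j k => |u j k|) n := by
  rw [norlundMean, abs_mul, abs_of_pos (inv_pos.2 (hs.pos n))]
  refine mul_le_mul_of_nonneg_left ?_ (inv_nonneg.2 (hs.pos n).le)
  refine (Finset.abs_sum_le_sum_abs _ _).trans_eq (Finset.sum_congr rfl fun k _ => ?_)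
  rw [abs_mul, abs_of_nonneg (hs.nonneg _)]

theorem MeanNull.tendsto_mean (hs : RegularWeights s) (hu : MeanNull s u) :
    Tendsto (norlundMean s u) atTop (nhds 0) :=
  squeeze_zero_norm (fun n => by simpa using hs.abs_mean_le u n) hu

theorem MeanNull.of_le (hs : RegularWeights s) (hv : MeanNull s v)
    (h : ∀ j k, |u j k| ≤ |v j k|) : MeanNull s u :=
  squeeze_zero (hs.mean_nonneg fun _ _ => abs_nonneg _) (hs.mean_mono h) hv

theorem MeanNull.add (hs : RegularWeights s) (hu : MeanNull s u) (hv : MeanNull s v) :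
    MeanNull s (fun j k => u j k + v j k) := by
  refine squeeze_zero (hs.mean_nonneg fun _ _ => abs_nonneg _)
    (fun n => ?_) (by simpa using Tendsto.add hu hv)
  rw [← norlundMean_add]
  exact hs.mean_mono (fun _ _ => abs_add_le _ _) n

theorem MeanNull.mul_bounded (hs : RegularWeights s) (hu : MeanNull s u) (hv : ArrayBounded v) :
    MeanNull s (fun j k => u j k * v j k) := by
  obtain ⟨C, hC⟩ := hv
  refine squeeze_zero (hs.mean_nonneg fun _ _ => abs_nonneg _)
    (fun n => ?_) (by simpa using Tendsto.const_mul C hu)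
  rw [← norlundMean_const_mul]
  refine hs.mean_mono (fun j k => ?_) n
  rw [abs_mul, mul_comm C]
  exact mul_le_mul_of_nonneg_left (hC j k) (abs_nonneg _)

theorem RegularWeights.tendsto_ratio (hs : RegularWeights s) :
    Tendsto (fun n => (∑ j ∈ Finset.range (n + 1), s j)⁻¹ * ∑ j ∈ Finset.range (n + 1 + 1), s j)
      atTop (nhds 1) := by
  have h := ((hs.tendsto.comp (tendsto_add_atTop_nat 1)).const_sub 1).inv₀ (by norm_num)
  simp only [sub_zero, inv_one] at h
  refine h.congr fun n => ?_
  have h1 := (hs.pos n).ne'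
  have h2 := (hs.pos (n + 1)).ne'
  have h3 := Finset.sum_range_succ s (n + 1)
  simp only [Function.comp]
  have h4 : 1 - s (n + 1) / ∑ j ∈ Finset.range (n + 1 + 1), s j
      = (∑ j ∈ Finset.range (n + 1), s j) / ∑ j ∈ Finset.range (n + 1 + 1), s j := by
    rw [eq_div_iff h2, sub_mul, div_mul_cancel₀ _ h2, h3]
    ring
  rw [h4, inv_div, div_eq_inv_mul]

theorem MeanNull.shift (hs : RegularWeights s) (hu : MeanNull s u) :
    MeanNull s (fun j k => u j (k + 1)) := by
  have h := hs.tendsto_ratio.mul (hu.comp (tendsto_add_atTop_nat 1))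
  rw [mul_zero] at h
  refine squeeze_zero (hs.mean_nonneg fun _ _ => abs_nonneg _) (fun n => ?_) h
  have h2 := (hs.pos (n + 1)).ne'
  simp only [Function.comp, norlundMean]
  rw [mul_assoc, mul_inv_cancel_left₀ h2, Finset.sum_range_succ' _ (n + 1)]
  simp only [Nat.add_sub_add_right]
  refine mul_le_mul_of_nonneg_left ?_ (inv_nonneg.2 (hs.pos n).le)
  exact le_add_of_nonneg_right (mul_nonneg (hs.nonneg _) (abs_nonneg _))

theorem MeanNull.shift_back (hs : RegularWeights s) (hb : ArrayBounded u) (hu : MeanNull s u) :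
    MeanNull s (fun j k => u j (k - 1)) := by
  obtain ⟨C, hC⟩ := hb
  have h := Tendsto.add hu ((hs.tendsto.comp (tendsto_add_atTop_nat 1)).mul_const C)
  rw [zero_mul, add_zero] at h
  refine (tendsto_add_atTop_iff_nat 1).1 ?_
  refine squeeze_zero (fun n => hs.mean_nonneg (fun _ _ => abs_nonneg _) _) (fun n => ?_) h
  have h3 := Finset.sum_range_succ s (n + 1)
  have hle : (∑ j ∈ Finset.range (n + 1 + 1), s j)⁻¹ ≤ (∑ j ∈ Finset.range (n + 1), s j)⁻¹ :=
    inv_anti₀ (hs.pos n) (by rw [h3]; linarith [hs.nonneg (n + 1)])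
  simp only [Function.comp, norlundMean]
  rw [Finset.sum_range_succ' (fun k => s (n + 1 - k) * |u (n + 1 - k) (k - 1)|) (n + 1), mul_add]
  simp only [Nat.add_sub_add_right, Nat.add_sub_cancel, Nat.sub_zero]
  refine add_le_add ?_ ?_
  · exact mul_le_mul_of_nonneg_right hle
      (Finset.sum_nonneg fun _ _ => mul_nonneg (hs.nonneg _) (abs_nonneg _))
  · rw [← mul_assoc, div_eq_inv_mul]
    exact mul_le_mul_of_nonneg_left (hC _ _)
      (mul_nonneg (inv_nonneg.2 (hs.pos _).le) (hs.nonneg _))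

end NorlundMean

/-- Bounded arrays that vary slowly in the mean and whose products with all monomials in `a` and
`b` have convergent Nörlund means. -/
structure MeanRegular (s : ℕ → ℝ) (a b u : ℕ → ℕ → ℝ) : Prop where
  bounded : ArrayBounded u
  slow : MeanNull s (fun j k => u j (k + 1) - u j k)
  tendsto : ∀ la lb : ℕ, ∃ t,
    Tendsto (norlundMean s fun j k => u j k * (a j k ^ la * b j k ^ lb)) atTop (nhds t)

namespace MeanRegular

variable {s : ℕ → ℝ} {a b u v : ℕ → ℕ → ℝ}

theorem of_sub_null (hs : RegularWeights s) (ha : ArrayBounded a) (hb : ArrayBounded b)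
    (hu : MeanRegular s a b u) (hv : ArrayBounded v) (h : MeanNull s (fun j k => v j k - u j k)) :
    MeanRegular s a b v where
  bounded := hv
  slow := by
    have h1 := (h.shift hs).add hs (hu.slow.add hs (h.mul_bounded hs ⟨1, fun _ _ => by
      show |(-1 : ℝ)| ≤ 1
      simp⟩))
    convert h1 using 3
    ring
  tendsto la lb := by
    obtain ⟨t, ht⟩ := hu.tendsto la lb
    refine ⟨0 + t, (((h.mul_bounded hs ((ha.pow la).mul (hb.pow lb))).tendsto_mean hs).add
      ht).congr fun n => ?_⟩
    rw [← norlundMean_add]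
    congr 1
    ext j k
    ring

theorem add (hs : RegularWeights s) (hu : MeanRegular s a b u) (hv : MeanRegular s a b v) :
    MeanRegular s a b (fun j k => u j k + v j k) where
  bounded := hu.bounded.add hv.bounded
  slow := by
    convert hu.slow.add hs hv.slow using 3
    ring
  tendsto la lb := by
    obtain ⟨t, ht⟩ := hu.tendsto la lb
    obtain ⟨r, hr⟩ := hv.tendsto la lb
    refine ⟨t + r, (ht.add hr).congr fun n => ?_⟩
    rw [← norlundMean_add]
    simp only [add_mul]

theorem slow_mul (hs : RegularWeights s) (hv : ArrayBounded v)
    (hv' : MeanNull s (fun j k => v j (k + 1) - v j k)) (hu : MeanRegular s a b u) :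
    MeanNull s (fun j k => v j (k + 1) * u j (k + 1) - v j k * u j k) := by
  obtain ⟨C, hC⟩ := hu.bounded
  have h := (hv'.mul_bounded (v := fun j k => u j (k + 1)) hs ⟨C, fun j k => hC j _⟩).add hs
    (hu.slow.mul_bounded hs hv)
  convert h using 3
  ring

theorem mul_left (hs : RegularWeights s) (ha : ArrayBounded a)
    (ha' : MeanNull s (fun j k => a j (k + 1) - a j k)) (hu : MeanRegular s a b u) :
    MeanRegular s a b (fun j k => a j k * u j k) where
  bounded := ha.mul hu.bounded
  slow := hu.slow_mul hs ha ha'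
  tendsto la lb := by
    obtain ⟨t, ht⟩ := hu.tendsto (la + 1) lb
    refine ⟨t, ht.congr fun n => ?_⟩
    congr 1
    ext j k
    ring

theorem mul_right (hs : RegularWeights s) (hb : ArrayBounded b)
    (hb' : MeanNull s (fun j k => b j (k + 1) - b j k)) (hu : MeanRegular s a b u) :
    MeanRegular s a b (fun j k => b j k * u j k) where
  bounded := hb.mul hu.bounded
  slow := hu.slow_mul hs hb hb'
  tendsto la lb := by
    obtain ⟨t, ht⟩ := hu.tendsto la (lb + 1)
    refine ⟨t, ht.congr fun n => ?_⟩
    congr 1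
    ext j k
    ring

theorem shift (hs : RegularWeights s) (ha : ArrayBounded a) (hb : ArrayBounded b)
    (hu : MeanRegular s a b u) : MeanRegular s a b (fun j k => u j (k + 1)) := by
  obtain ⟨C, hC⟩ := hu.bounded
  exact hu.of_sub_null hs ha hb ⟨C, fun j k => hC j _⟩ hu.slow

theorem shift_back (hs : RegularWeights s) (ha : ArrayBounded a) (hb : ArrayBounded b)
    (hu : MeanRegular s a b u) : MeanRegular s a b (fun j k => u j (k - 1)) := by
  obtain ⟨C, hC⟩ := hu.bounded
  refine hu.of_sub_null hs ha hb ⟨C, fun j k => hC j _⟩ ?_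
  refine (hu.slow.shift_back hs ⟨C + C, fun j k => ?_⟩).of_le hs fun j k => ?_
  · exact (abs_sub _ _).trans (add_le_add (hC _ _) (hC _ _))
  · cases k with
    | zero => simp
    | succ k => simp [abs_sub_comm]

theorem const
    (h : ∀ la lb : ℕ, ∃ t, Tendsto (norlundMean s fun j k => a j k ^ la * b j k ^ lb)
      atTop (nhds t)) (c : ℝ) : MeanRegular s a b (fun _ _ => c) where
  bounded := ⟨|c|, fun _ _ => le_rfl⟩
  slow := by simp [MeanNull,
    show norlundMean s (fun _ _ => 0) = fun _ => 0 by ext; simp [norlundMean]]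
  tendsto la lb := by
    obtain ⟨t, ht⟩ := h la lb
    exact ⟨c * t, (ht.const_mul c).congr fun n => (norlundMean_const_mul _ _ _ _).symm⟩

end MeanRegular

/-- The matrix entry `(J ^ m) k (k + d)` of the Jacobi matrix `J` with coefficients `a j`, `b j`,
as a double array indexed by `j` and `k`. -/
def jacobiPow (a b : ℕ → ℕ → ℝ) : ℕ → ℤ → ℕ → ℕ → ℝ
  | 0, d, _, _ => if d = 0 then 1 else 0
  | m + 1, d, j, k => b j (k + 1) * jacobiPow a b m (d - 1) j (k + 1) +
      a j k * jacobiPow a b m d j k + b j k * jacobiPow a b m (d + 1) j (k - 1)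

theorem meanRegular_jacobiPow {s : ℕ → ℝ} {a b : ℕ → ℕ → ℝ} (hs : RegularWeights s)
    (ha : ArrayBounded a) (hb : ArrayBounded b)
    (ha' : MeanNull s (fun j k => a j (k + 1) - a j k))
    (hb' : MeanNull s (fun j k => b j (k + 1) - b j k))
    (h : ∀ la lb : ℕ, ∃ t, Tendsto (norlundMean s fun j k => a j k ^ la * b j k ^ lb)
      atTop (nhds t)) (m : ℕ) :
    ∀ d, MeanRegular s a b (jacobiPow a b m d) := by
  induction m with
  | zero => exact fun d => MeanRegular.const h _
  | succ m ih =>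
    exact fun d => ((((ih (d - 1)).mul_right hs hb hb').shift hs ha hb).add hs
      ((ih d).mul_left hs ha ha')).add hs (((ih (d + 1)).shift_back hs ha hb).mul_right hs hb hb')

theorem sum_partial_sum_eq_sum_antidiagonal (s : ℕ → ℝ) (u : ℕ → ℕ → ℝ) (n : ℕ) :
    ∑ k ∈ Finset.range (n + 1), s (n - k) * ∑ i ∈ Finset.range (k + 1), u (n - k) i =
      ∑ m ∈ Finset.range (n + 1), ∑ k ∈ Finset.range (m + 1), s (m - k) * u (m - k) k := by
  induction n with
  | zero => simp
  | succ n ih =>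
    rw [Finset.sum_range_succ (fun m => ∑ k ∈ Finset.range (m + 1), s (m - k) * u (m - k) k) (n + 1),
      ← ih]
    have h : ∑ k ∈ Finset.range (n + 1 + 1),
        s (n + 1 - k) * ∑ i ∈ Finset.range (k + 1), u (n + 1 - k) i =
        ∑ k ∈ Finset.range (n + 1 + 1), s (n + 1 - k) * ∑ i ∈ Finset.range k, u (n + 1 - k) i +
        ∑ k ∈ Finset.range (n + 1 + 1), s (n + 1 - k) * u (n + 1 - k) k := by
      rw [← Finset.sum_add_distrib]
      exact Finset.sum_congr rfl fun k _ => by rw [Finset.sum_range_succ, mul_add]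
    rw [h, Finset.sum_range_succ' _ (n + 1)]
    simp

theorem tendsto_weighted_cesaro {w x : ℕ → ℝ} {t : ℝ} (hw : ∀ n, 0 < w n)
    (hW : Tendsto (fun n => ∑ k ∈ Finset.range n, w k) atTop atTop)
    (hx : Tendsto x atTop (nhds t)) :
    Tendsto (fun n => (∑ k ∈ Finset.range n, w k)⁻¹ * ∑ k ∈ Finset.range n, w k * x k)
      atTop (nhds t) := by
  have h1 : (fun n => w n * (x n - t)) =o[atTop] w := by
    refine (Asymptotics.isLittleO_iff_tendsto' (Eventually.of_forall fun n h =>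
      absurd h (hw n).ne')).2 ?_
    refine (tendsto_sub_nhds_zero_iff.2 hx).congr fun n => ?_
    rw [mul_div_cancel_left₀ _ (hw n).ne']
  have h2 := (h1.sum_range (fun n => (hw n).le) hW).tendsto_div_nhds_zero
  refine tendsto_sub_nhds_zero_iff.1 (h2.congr' ?_)
  filter_upwards [hW.eventually_gt_atTop 0] with n hn
  simp only [mul_sub, Finset.sum_sub_distrib, ← Finset.sum_mul]
  field_simp

/-- Positive linear functionals on the continuous functions on `ℝ` that only depend on the values
on `[-K, K]`. -/
structure IsPositiveFunctionalOn (K : ℝ) (L : (ℝ → ℝ) → ℝ) : Prop where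
  add : ∀ f g, Continuous f → Continuous g → L (fun x => f x + g x) = L f + L g
  smul : ∀ (c : ℝ) f, Continuous f → L (fun x => c * f x) = c * L f
  mono : ∀ f g, Continuous f → Continuous g → (∀ x ∈ Set.Icc (-K) K, f x ≤ g x) → L f ≤ L g

namespace IsPositiveFunctionalOn

variable {ι : Type*} {l : Filter ι} {K : ℝ} {L : ι → (ℝ → ℝ) → ℝ} {c : ℕ → ℝ}

theorem congr {Λ : (ℝ → ℝ) → ℝ} (hΛ : IsPositiveFunctionalOn K Λ) {f g : ℝ → ℝ}
    (hf : Continuous f) (hg : Continuous g) (h : ∀ x ∈ Set.Icc (-K) K, f x = g x) : Λ f = Λ g :=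
  le_antisymm (hΛ.mono f g hf hg fun x hx => (h x hx).le)
    (hΛ.mono g f hg hf fun x hx => (h x hx).ge)

theorem sub_le {Λ : (ℝ → ℝ) → ℝ} (hΛ : IsPositiveFunctionalOn K Λ) {f g : ℝ → ℝ} {ε : ℝ}
    (hf : Continuous f) (hg : Continuous g) (h : ∀ x ∈ Set.Icc (-K) K, f x - g x ≤ ε) :
    Λ f - Λ g ≤ ε * Λ (fun _ => 1) := by
  have h1 := hΛ.mono f (fun x => g x + ε * 1) hf (by fun_prop)
    (fun x hx => by linarith [h x hx])
  rw [hΛ.add g (fun _ => ε * 1) hg continuous_const, hΛ.smul ε (fun _ => 1) continuous_const] at h1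
  linarith

theorem abs_sub_le {Λ : (ℝ → ℝ) → ℝ} (hΛ : IsPositiveFunctionalOn K Λ) {f g : ℝ → ℝ} {ε : ℝ}
    (hf : Continuous f) (hg : Continuous g) (h : ∀ x ∈ Set.Icc (-K) K, |f x - g x| ≤ ε) :
    |Λ f - Λ g| ≤ ε * Λ (fun _ => 1) := by
  have h1 := hΛ.sub_le hf hg fun x hx => (abs_le.1 (h x hx)).2
  have h2 := hΛ.sub_le (ε := ε) hg hf fun x hx => by linarith [(abs_le.1 (h x hx)).1]
  exact abs_le.2 ⟨by linarith, h1⟩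

theorem exists_tendsto_polynomial (hL : ∀ i, IsPositiveFunctionalOn K (L i))
    (hm : ∀ m : ℕ, Tendsto (fun i => L i fun x => x ^ m) l (nhds (c m))) (q : Polynomial ℝ) :
    ∃ t, Tendsto (fun i => L i fun x => q.eval x) l (nhds t) := by
  induction q using Polynomial.induction_on' with
  | add p q hp hq =>
    obtain ⟨t, ht⟩ := hp
    obtain ⟨r, hr⟩ := hq
    refine ⟨t + r, (ht.add hr).congr fun i => ?_⟩
    simp only [Polynomial.eval_add]
    exact ((hL i).add _ _ p.continuous q.continuous).symm
  | monomial m a =>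
    refine ⟨a * c m, ((hm m).const_mul a).congr fun i => ?_⟩
    simp only [Polynomial.eval_monomial]
    exact ((hL i).smul _ _ (continuous_pow m)).symm

theorem exists_tendsto [l.NeBot] (hL : ∀ i, IsPositiveFunctionalOn K (L i))
    (hm : ∀ m : ℕ, Tendsto (fun i => L i fun x => x ^ m) l (nhds (c m)))
    {f : ℝ → ℝ} (hf : Continuous f) : ∃ t, Tendsto (fun i => L i f) l (nhds t) := by
  refine cauchy_map_iff_exists_tendsto.1 (Metric.cauchy_iff.2 ⟨inferInstance, fun ε hε => ?_⟩)
  have h0 : ∀ᶠ i in l, L i (fun _ => 1) < |c 0| + 1 := by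
    have := hm 0
    simp only [pow_zero] at this
    exact this.eventually_lt_const (by linarith [le_abs_self (c 0)])
  have hC : 0 < |c 0| + 1 := by positivity
  obtain ⟨q, hq⟩ := exists_polynomial_near_of_continuousOn (-K) K f hf.continuousOn
    (ε / 4 / (|c 0| + 1)) (by positivity)
  obtain ⟨t, ht⟩ := exists_tendsto_polynomial hL hm q
  have h1 := (Metric.tendsto_nhds.1 ht) (ε / 4) (by positivity)
  have h2 : ∀ᶠ i in l, |L i f - t| < ε / 2 := by
    filter_upwards [h0, h1] with i hi hi'
    have h3 := (hL i).abs_sub_le hf q.continuous (ε := ε / 4 / (|c 0| + 1))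
      fun x hx => by rw [abs_sub_comm]; exact (hq x hx).le
    have h4 : ε / 4 / (|c 0| + 1) * L i (fun _ => 1) ≤ ε / 4 := by
      calc _ ≤ ε / 4 / (|c 0| + 1) * (|c 0| + 1) := by gcongr
        _ = ε / 4 := by field_simp
    rw [Real.dist_eq] at hi'
    calc |L i f - t| ≤ _ := _root_.abs_sub_le _ (L i fun x => q.eval x) _
      _ < ε / 2 := by linarith
  refine ⟨_, image_mem_map h2, ?_⟩
  rintro _ ⟨i, hi, rfl⟩ _ ⟨j, hj, rfl⟩
  rw [Real.dist_eq]
  have h5 : |L j f - t| < ε / 2 := hj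
  rw [abs_sub_comm] at h5
  calc |L i f - L j f| ≤ _ := _root_.abs_sub_le _ t _
    _ < ε := by linarith [show |L i f - t| < ε / 2 from hi]

open CompactlySupported in
theorem exists_measure [l.NeBot] (hK : 0 ≤ K) (hL : ∀ i, IsPositiveFunctionalOn K (L i))
    (hm : ∀ m : ℕ, Tendsto (fun i => L i fun x => x ^ m) l (nhds (c m))) :
    ∃ μ : Measure ℝ, IsFiniteMeasure μ ∧
      ∀ f : ℝ → ℝ, Continuous f → Tendsto (fun i => L i f) l (nhds (∫ x, f x ∂μ)) := by
  have hKK : -K ≤ K := by linarith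
  have hex : ∀ f : C_c(Set.Icc (-K) K, ℝ), ∃ t,
      Tendsto (fun i => L i (Set.IccExtend hKK f)) l (nhds t) :=
    fun f => exists_tendsto hL hm f.continuous.Icc_extend'
  choose Φ hΦ using hex
  let Λ : C_c(Set.Icc (-K) K, ℝ) →ₚ[ℝ] ℝ := PositiveLinearMap.mk₀
    { toFun := Φ
      map_add' := fun f g => by
        refine tendsto_nhds_unique (hΦ (f + g)) (((hΦ f).add (hΦ g)).congr fun i => ?_)
        exact ((hL i).add _ _ f.continuous.Icc_extend' g.continuous.Icc_extend').symm
      map_smul' := fun r f => by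
        refine tendsto_nhds_unique (hΦ (r • f)) (((hΦ f).const_mul r).congr fun i => ?_)
        exact ((hL i).smul _ _ f.continuous.Icc_extend').symm }
    (fun f hf => by
      refine ge_of_tendsto' (hΦ f) fun i => ?_
      have h0 : L i (fun _ => 0) = 0 := by
        simpa using (hL i).smul 0 (fun _ => 0) continuous_const
      rw [← h0]
      exact (hL i).mono _ _ continuous_const f.continuous.Icc_extend' fun x _ => hf _)
  refine ⟨(RealRMK.rieszMeasure Λ).map Subtype.val, inferInstance, fun f hf => ?_⟩
  rw [(MeasurableEmbedding.subtype_coe measurableSet_Icc).integral_map]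
  let g : C_c(Set.Icc (-K) K, ℝ) := CompactlySupportedContinuousMap.continuousMapEquiv
    ⟨fun x => f x, hf.comp continuous_subtype_val⟩
  have h1 : ∫ x : Set.Icc (-K) K, f x ∂(RealRMK.rieszMeasure Λ) = Φ g :=
    RealRMK.integral_rieszMeasure Λ g
  rw [h1]
  refine (hΦ g).congr fun i => ?_
  refine (hL i).congr g.continuous.Icc_extend' hf fun x hx => ?_
  rw [Set.IccExtend_of_mem _ _ hx]
  rfl

/-- Two sequences of positive functionals with the same limits of moments converge to a common
finite measure. -/
theorem exists_common_measure (hK : 0 ≤ K) {L L' : ℕ → (ℝ → ℝ) → ℝ}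
    (hL : ∀ n, IsPositiveFunctionalOn K (L n)) (hL' : ∀ n, IsPositiveFunctionalOn K (L' n))
    (hm : ∀ m : ℕ, Tendsto (fun n => L n fun x => x ^ m) atTop (nhds (c m)))
    (hm' : ∀ m : ℕ, Tendsto (fun n => L' n fun x => x ^ m) atTop (nhds (c m))) :
    ∃ μ : Measure ℝ, IsFiniteMeasure μ ∧ ∀ f : ℝ → ℝ, Continuous f →
      Tendsto (fun n => L n f) atTop (nhds (∫ x, f x ∂μ)) ∧
      Tendsto (fun n => L' n f) atTop (nhds (∫ x, f x ∂μ)) := by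
  obtain ⟨μ, hμ, h⟩ := exists_measure (l := map Sum.inl atTop ⊔ map Sum.inr atTop)
    (L := Sum.elim L L') (c := c) hK (by rintro (n | n); exacts [hL n, hL' n])
    (fun m => tendsto_sup.2 ⟨tendsto_map'_iff.2 (hm m), tendsto_map'_iff.2 (hm' m)⟩)
  refine ⟨μ, hμ, fun f hf => ?_⟩
  obtain ⟨h1, h2⟩ := tendsto_sup.1 (h f hf)
  exact ⟨tendsto_map'_iff.1 h1, tendsto_map'_iff.1 h2⟩

end IsPositiveFunctionalOn

theorem integrable_of_continuous {μ : Measure ℝ} [IsFiniteMeasure μ] {R : ℝ}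
    (hμ : μ (Set.Icc (-R) R)ᶜ = 0) {f : ℝ → ℝ} (hf : Continuous f) : Integrable f μ := by
  have h : μ.restrict (Set.Icc (-R) R) = μ := Measure.restrict_eq_self_of_ae_mem hμ
  rw [← h]
  exact hf.continuousOn.integrableOn_compact isCompact_Icc

theorem integral_pow_mul_eq_jacobiPow {μ : Measure ℝ} [IsFiniteMeasure μ] {R : ℝ}
    (hμ : μ (Set.Icc (-R) R)ᶜ = 0) {p : ℕ → Polynomial ℝ} {a b : ℕ → ℕ → ℝ} {j : ℕ}
    (horth : ∀ l m, ∫ x, (p l).eval x * (p m).eval x ∂μ = if l = m then 1 else 0)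
    (hb0 : b j 0 = 0)
    (hrec : ∀ l x, x * (p l).eval x =
      b j (l + 1) * (p (l + 1)).eval x + a j l * (p l).eval x + b j l * (p (l - 1)).eval x)
    (m : ℕ) : ∀ k l : ℕ, ∫ x, x ^ m * (p k).eval x * (p l).eval x ∂μ =
      jacobiPow a b m (l - k) j k := by
  induction m with
  | zero =>
    intro k l
    simp only [pow_zero, one_mul, horth, jacobiPow, sub_eq_zero, Nat.cast_inj, eq_comm]
  | succ m ih =>
    intro k l
    have hint : ∀ (c : ℝ) i,
        Integrable (fun x => c * (x ^ m * (p i).eval x * (p l).eval x)) μ := fun c i =>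
      integrable_of_continuous hμ (by fun_prop)
    have h : ∀ x, x ^ (m + 1) * (p k).eval x * (p l).eval x =
        b j (k + 1) * (x ^ m * (p (k + 1)).eval x * (p l).eval x) +
        a j k * (x ^ m * (p k).eval x * (p l).eval x) +
        b j k * (x ^ m * (p (k - 1)).eval x * (p l).eval x) := fun x => by
      linear_combination x ^ m * (p l).eval x * hrec k x
    simp only [h]
    rw [integral_add ((hint _ _).fun_add (hint _ _)) (hint _ _), integral_add (hint _ _) (hint _ _)]
    simp only [integral_const_mul, ih, jacobiPow]
    refine congrArg₂ (· + ·) ?_ ?_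
    · push_cast
      ring_nf
    · cases k with
      | zero => simp [hb0]
      | succ k =>
        simp only [Nat.add_sub_cancel]
        push_cast
        ring_nf

/-- The entries of the `m`-th power of the `K × K` truncation of the Jacobi matrix with
coefficients `a`, `b`. -/
def truncatedPow (a b : ℕ → ℝ) (K : ℕ) : ℕ → ℕ → ℕ → ℝ
  | 0, k, l => if k = l then 1 else 0
  | m + 1, k, l => (if k + 1 < K then b (k + 1) * truncatedPow a b K m (k + 1) l else 0) +
      a k * truncatedPow a b K m k l + b k * truncatedPow a b K m (k - 1) l

theorem abs_truncatedPow_le {a b : ℕ → ℝ} {M : ℝ} (ha : ∀ k, |a k| ≤ M) (hb : ∀ k, |b k| ≤ M)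
    (K m : ℕ) : ∀ k l, |truncatedPow a b K m k l| ≤ (3 * M) ^ m := by
  have hM : 0 ≤ M := (abs_nonneg _).trans (ha 0)
  induction m with
  | zero =>
    intro k l
    simp only [truncatedPow, pow_zero]
    split_ifs <;> simp
  | succ m ih =>
    intro k l
    have hmul : ∀ r i, |r| ≤ M → |r * truncatedPow a b K m i l| ≤ M * (3 * M) ^ m := by
      intro r i hr
      rw [abs_mul]
      exact mul_le_mul hr (ih _ _) (abs_nonneg _) hM
    have h1 : |if k + 1 < K then b (k + 1) * truncatedPow a b K m (k + 1) l else 0| ≤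
        M * (3 * M) ^ m := by
      split_ifs
      · exact hmul _ _ (hb _)
      · simpa using by positivity
    calc _ ≤ _ := abs_add_three _ _ _
      _ ≤ M * (3 * M) ^ m + M * (3 * M) ^ m + M * (3 * M) ^ m :=
        add_le_add (add_le_add h1 (hmul _ _ (ha _))) (hmul _ _ (hb _))
      _ = (3 * M) ^ (m + 1) := by ring

theorem truncatedPow_eq_jacobiPow {a b : ℕ → ℕ → ℝ} {j : ℕ} (hb0 : b j 0 = 0) {K : ℕ} (m : ℕ) :
    ∀ k l : ℕ, k + m < K → truncatedPow (a j) (b j) K m k l = jacobiPow a b m (l - k) j k := by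
  induction m with
  | zero =>
    intro k l _
    simp only [truncatedPow, jacobiPow, sub_eq_zero, Nat.cast_inj, eq_comm]
  | succ m ih =>
    intro k l hk
    simp only [truncatedPow, jacobiPow]
    rw [if_pos (by omega), ih _ _ (by omega), ih _ _ (by omega), ih _ _ (by omega)]
    refine congrArg₂ (· + ·) ?_ ?_
    · push_cast
      ring_nf
    · cases k with
      | zero => simp [hb0]
      | succ k =>
        simp only [Nat.add_sub_cancel]
        push_cast
        ring_nf

theorem pow_mul_eq_sum_truncatedPow {a b y : ℕ → ℝ} {x : ℝ} {K : ℕ}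
    (hrec : ∀ k, x * y k = b (k + 1) * y (k + 1) + a k * y k + b k * y (k - 1)) (hK : y K = 0)
    (m : ℕ) : ∀ k < K, ∑ l ∈ Finset.range K, truncatedPow a b K m k l * y l = x ^ m * y k := by
  induction m with
  | zero =>
    intro k hk
    simp [truncatedPow, hk]
  | succ m ih =>
    intro k hk
    simp only [truncatedPow, add_mul, Finset.sum_add_distrib, mul_assoc, ← Finset.mul_sum]
    rw [ih k hk, ih (k - 1) (by omega)]
    have h : ∑ l ∈ Finset.range K,
        (if k + 1 < K then b (k + 1) * truncatedPow a b K m (k + 1) l else 0) * y l =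
        b (k + 1) * (x ^ m * y (k + 1)) := by
      split_ifs with hk'
      · simp only [mul_assoc, ← Finset.mul_sum]
        rw [ih _ hk']
      · rw [show k + 1 = K by omega, hK]
        simp
    rw [h]
    linear_combination -x ^ m * hrec k

theorem det_eval_ne_zero {p : ℕ → Polynomial ℝ} (hdeg : ∀ l, (p l).degree = l) {K : ℕ}
    {x : Fin K → ℝ} (hx : Function.Injective x) :
    (Matrix.of fun i j : Fin K => (p i).eval (x j)).det ≠ 0 := by
  intro h
  obtain ⟨v, hv, hv0⟩ := Matrix.exists_vecMul_eq_zero_iff.2 h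
  have hK : K ≠ 0 := by
    rintro rfl
    exact hv (Subsingleton.elim _ _)
  have hlin : LinearIndependent ℝ fun i : Fin K => p i :=
    (Polynomial.Sequence.linearIndependent ⟨p, hdeg⟩).comp _ Fin.val_injective
  have hq : ∑ i : Fin K, v i • p i = 0 := by
    refine Polynomial.eq_zero_of_natDegree_lt_card_of_eval_eq_zero _ hx (fun j => ?_) ?_
    · have := congrFun hv0 j
      simpa [Matrix.vecMul, dotProduct, Polynomial.eval_finsetSum] using this
    · rw [Fintype.card_fin]
      refine lt_of_le_of_lt (Polynomial.natDegree_sum_le_of_forall_le (n := K - 1) _ _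
        fun i _ => ?_) (by omega)
      refine (Polynomial.natDegree_smul_le _ _).trans ?_
      rw [Polynomial.natDegree_eq_of_degree_eq_some (hdeg i)]
      omega
  exact hv (funext (Fintype.linearIndependent_iff.1 hlin v hq))

theorem sum_pow_roots_eq_trace {p : ℕ → Polynomial ℝ} (hdeg : ∀ l, (p l).degree = l)
    {a b : ℕ → ℝ} (hrec : ∀ l x, x * (p l).eval x =
      b (l + 1) * (p (l + 1)).eval x + a l * (p l).eval x + b l * (p (l - 1)).eval x)
    {K : ℕ} {x : Fin K → ℝ} (hx : Function.Injective x) (hroot : ∀ i, (p K).eval (x i) = 0)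
    (m : ℕ) : ∑ i, x i ^ m = ∑ i ∈ Finset.range K, truncatedPow a b K m i i := by
  set V : Matrix (Fin K) (Fin K) ℝ := Matrix.of fun i j => (p i).eval (x j) with hV
  set T : Matrix (Fin K) (Fin K) ℝ := Matrix.of fun i j => truncatedPow a b K m i j with hT
  have hdet : IsUnit V.det := (det_eval_ne_zero hdeg hx).isUnit
  have hTV : T * V = V * Matrix.diagonal fun j => x j ^ m := by
    ext i j
    rw [Matrix.mul_diagonal, Matrix.mul_apply]
    have := pow_mul_eq_sum_truncatedPow (y := fun l => (p l).eval (x j))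
      (fun l => hrec l (x j)) (hroot j) m i i.2
    rw [Finset.sum_range] at this
    simpa [hV, hT, mul_comm (x j ^ m)] using this
  have htr : T.trace = (Matrix.diagonal fun j => x j ^ m).trace := by
    rw [← Matrix.mul_nonsing_inv_cancel_right V T hdet, hTV, Matrix.trace_mul_comm,
      Matrix.nonsing_inv_mul_cancel_left V _ hdet]
  rw [Matrix.trace_diagonal] at htr
  rw [← htr, Finset.sum_range]
  rfl

theorem abs_root_le {p : ℕ → Polynomial ℝ} (hdeg : ∀ l, (p l).degree = l)
    {a b : ℕ → ℝ} {M : ℝ} (ha : ∀ k, |a k| ≤ M) (hb : ∀ k, |b k| ≤ M)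
    (hrec : ∀ l x, x * (p l).eval x =
      b (l + 1) * (p (l + 1)).eval x + a l * (p l).eval x + b l * (p (l - 1)).eval x)
    {n : ℕ} {x : ℝ} (hx : (p (n + 1)).eval x = 0) : |x| ≤ 3 * M := by
  have hM : 0 ≤ M := (abs_nonneg _).trans (ha 0)
  obtain ⟨i, hi, hmax⟩ := Finset.exists_max_image (Finset.range (n + 1))
    (fun l => |(p l).eval x|) ⟨0, by simp⟩
  have h0 : (p 0).eval x ≠ 0 := by
    have h := hdeg 0
    rw [Polynomial.eq_C_of_degree_le_zero h.le, Polynomial.eval_C]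
    intro h'
    rw [Polynomial.eq_C_of_degree_le_zero h.le, h'] at h
    simp at h
  have hpos : 0 < |(p i).eval x| := (abs_pos.2 h0).trans_le (hmax 0 (by simp))
  have hle : ∀ l ≤ n + 1, |(p l).eval x| ≤ |(p i).eval x| := by
    intro l hl
    rcases hl.eq_or_lt with rfl | hl
    · simp [hx]
    · exact hmax l (by simpa using hl)
  have hi' := Finset.mem_range.1 hi
  have hmul : ∀ r l, |r| ≤ M → l ≤ n + 1 → |r * (p l).eval x| ≤ M * |(p i).eval x| := by
    intro r l hr hl
    rw [abs_mul]
    exact mul_le_mul hr (hle l hl) (abs_nonneg _) hM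
  refine le_of_mul_le_mul_right ?_ hpos
  rw [← abs_mul, hrec i x]
  calc _ ≤ _ := abs_add_three _ _ _
    _ ≤ M * |(p i).eval x| + M * |(p i).eval x| + M * |(p i).eval x| :=
      add_le_add (add_le_add (hmul _ _ (hb _) (by omega)) (hmul _ _ (ha _) (by omega)))
        (hmul _ _ (hb _) (by omega))
    _ = 3 * M * |(p i).eval x| := by ring

theorem abs_sum_truncatedPow_sub_le {a b : ℕ → ℕ → ℝ} {j : ℕ} (hb0 : b j 0 = 0) {M C : ℝ}
    (ha : ∀ k, |a j k| ≤ M) (hb : ∀ k, |b j k| ≤ M) {m : ℕ}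
    (hC : ∀ k, |jacobiPow a b m 0 j k| ≤ C) (K : ℕ) :
    |∑ i ∈ Finset.range K, truncatedPow (a j) (b j) K m i i -
      ∑ i ∈ Finset.range K, jacobiPow a b m 0 j i| ≤ m * ((3 * M) ^ m + C) := by
  have hM : 0 ≤ M := (abs_nonneg _).trans (ha 0)
  have hC0 : 0 ≤ C := (abs_nonneg _).trans (hC 0)
  rw [← Finset.sum_sub_distrib]
  have hsub : Finset.Ico (K - m) K ⊆ Finset.range K := fun i hi => by
    simp only [Finset.mem_Ico, Finset.mem_range] at hi ⊢
    exact hi.2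
  rw [← Finset.sum_subset hsub fun i hi hi' => ?_]
  · refine (Finset.abs_sum_le_sum_abs _ _).trans ?_
    refine (Finset.sum_le_card_nsmul _ _ ((3 * M) ^ m + C) fun i _ => ?_).trans ?_
    · exact (abs_sub _ _).trans (add_le_add (abs_truncatedPow_le ha hb _ _ _ _) (hC _))
    · rw [Nat.card_Ico, nsmul_eq_mul]
      refine mul_le_mul_of_nonneg_right ?_ (by positivity)
      exact_mod_cast (by omega : K - (K - m) ≤ m)
  · simp only [Finset.mem_Ico, Finset.mem_range, not_and_or, not_le, not_lt] at hi hi'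
    rw [truncatedPow_eq_jacobiPow hb0 m i i (by omega), sub_self, sub_self]

theorem RegularWeights.tendsto_mean_partial_sums {s : ℕ → ℝ} (hs : RegularWeights s)
    {u : ℕ → ℕ → ℝ} {t : ℝ} (hu : Tendsto (norlundMean s u) atTop (nhds t)) :
    Tendsto (fun n => (∑ m ∈ Finset.range (n + 1), ∑ j ∈ Finset.range (m + 1), s j)⁻¹ *
      ∑ k ∈ Finset.range (n + 1), s (n - k) * ∑ i ∈ Finset.range (k + 1), u (n - k) i)
      atTop (nhds t) := by
  have hW : Tendsto (fun n => ∑ m ∈ Finset.range n, ∑ j ∈ Finset.range (m + 1), s j)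
      atTop atTop := by
    refine tendsto_atTop_mono (fun n => ?_)
      (tendsto_natCast_atTop_atTop.atTop_mul_const (by simpa using hs.pos 0 : 0 < s 0))
    rw [← nsmul_eq_mul]
    refine (Finset.card_nsmul_le_sum _ _ (s 0) fun m _ => ?_).trans_eq' (by simp)
    exact Finset.single_le_sum (fun j _ => hs.nonneg j) (by simp)
  refine ((tendsto_weighted_cesaro hs.pos hW hu).comp (tendsto_add_atTop_nat 1)).congr fun n => ?_
  simp only [Function.comp]
  rw [sum_partial_sum_eq_sum_antidiagonal]
  refine congrArg _ (Finset.sum_congr rfl fun m _ => ?_)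
  rw [norlundMean, mul_inv_cancel_left₀ (hs.pos m).ne']

theorem stmt7
    (μ : ℕ → MeasureTheory.Measure ℝ)
    (hfin : ∀ k, MeasureTheory.IsFiniteMeasure (μ k))
    (hsupp : ∃ R : ℝ, ∀ k, μ k ((Set.Icc (-R) R)ᶜ) = 0)
    (p : ℕ → ℕ → Polynomial ℝ) (ca cb : ℕ → ℕ → ℝ)
    (hdeg : ∀ k l, (p k l).natDegree = l)
    (hlead : ∀ k l, 0 < (p k l).leadingCoeff)
    (horth : ∀ k l m, (∫ x, (p k l).eval x * (p k m).eval x ∂ (μ k)) = if l = m then 1 else 0)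
    (hb0 : ∀ k, cb k 0 = 0)
    (hbpos : ∀ k l, 0 < cb k (l+1))
    (hrec : ∀ k l, Polynomial.X * p k l =
      Polynomial.C (cb k (l+1)) * p k (l+1) + Polynomial.C (ca k l) * p k l +
      Polynomial.C (cb k l) * p k (l-1))
    (xr : ℕ → ℕ → ℕ → ℝ)
    (hroot : ∀ k n j, 1 ≤ j → j ≤ n+1 → (p k (n+1)).eval (xr k (n+1) j) = 0)
    (hrootlt : ∀ k n i j, 1 ≤ i → i < j → j ≤ n+1 → xr k (n+1) i < xr k (n+1) j)
    (σ : ℕ → ℕ → ℝ)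
    (hσ0 : ∀ n k, k ≤ n → 0 ≤ σ n k)
    (hσ1 : ∀ n, ∑ k ∈ Finset.range (n+1), σ n k = 1)
    (hσ2 : ∀ k, Filter.Tendsto (fun n => σ n k) Filter.atTop (nhds 0))
    (σs : ℕ → ℝ) (hσs : ∀ j, 0 ≤ σs j)
    (τ : ℕ → ℝ) (hτ : ∀ n, τ n = (∑ j ∈ Finset.range (n+1), σs j)⁻¹)
    (hτpos : ∀ n, 0 < τ n)
    (hfac : ∀ n k, k ≤ n → σ n k = τ n * σs (n-k))
    (N : ℕ → ℝ) (hN : ∀ n, N n = τ n * ∑ k ∈ Finset.range (n+1), (τ k)⁻¹)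
    (hNinf : Filter.Tendsto N Filter.atTop Filter.atTop)
    (Slim : ℕ → ℕ → ℝ)
    (hbdA : ∃ A : ℝ, ∀ k n, |ca k n| ≤ A)
    (hbdB : ∃ B : ℝ, ∀ k n, cb k n ≤ B)
    (hNa : ∀ l : ℕ, 1 ≤ l → Filter.Tendsto
      (fun n => ∑ k ∈ Finset.range (n+1), σ n k * |ca (n-k) (k+l) - ca (n-k) k|)
      Filter.atTop (nhds 0))
    (hNb : ∀ l : ℕ, 1 ≤ l → Filter.Tendsto
      (fun n => ∑ k ∈ Finset.range (n+1), σ n k * |cb (n-k) (k+l) - cb (n-k) k|)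
      Filter.atTop (nhds 0))
    (hNs : ∀ la lb : ℕ, Filter.Tendsto
      (fun n => ∑ k ∈ Finset.range (n+1), σ n k * (ca (n-k) k)^la * (cb (n-k) k)^lb)
      Filter.atTop (nhds (Slim la lb)))
    :
    ∃ μS : MeasureTheory.Measure ℝ, MeasureTheory.IsFiniteMeasure μS ∧
      (∀ f : ℝ → ℝ, Continuous f → (∃ C : ℝ, ∀ x, |f x| ≤ C) →
        (Filter.Tendsto (fun n => ∑ k ∈ Finset.range (n+1),
          σ n k * ∫ x, f x * ((p (n-k) k).eval x)^2 ∂ (μ (n-k)))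
          Filter.atTop (nhds (∫ x, f x ∂ μS))) ∧
        (Filter.Tendsto (fun n => (1 / N n) * ∑ k ∈ Finset.range (n+1),
          σ n k * ∑ j ∈ Finset.Icc 1 (k+1), f (xr (n-k) (k+1) j))
          Filter.atTop (nhds (∫ x, f x ∂ μS)))) := by
  obtain ⟨R, hR⟩ := hsupp
  obtain ⟨A, hA⟩ := hbdA
  obtain ⟨B, hB⟩ := hbdB
  have hs : RegularWeights σs := by
    refine ⟨hσs, fun n => ?_, (hσ2 0).congr fun n => ?_⟩
    · have := hτpos n
      rwa [hτ n, inv_pos] at this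
    · rw [hfac n 0 n.zero_le, hτ n, Nat.sub_zero, div_eq_inv_mul]
  have hmean : ∀ (u : ℕ → ℕ → ℝ) n,
      ∑ k ∈ Finset.range (n + 1), σ n k * u (n - k) k = norlundMean σs u n := by
    intro u n
    rw [norlundMean, ← hτ n, Finset.mul_sum]
    refine Finset.sum_congr rfl fun k hk => ?_
    rw [hfac n k (Nat.lt_succ_iff.1 (Finset.mem_range.1 hk)), mul_assoc]
  have hbnonneg : ∀ k l, 0 ≤ cb k l := by
    rintro k (_ | l)
    exacts [(hb0 k).ge, (hbpos k l).le]
  obtain ⟨M, hMa, hMb⟩ : ∃ M, (∀ k l, |ca k l| ≤ M) ∧ ∀ k l, |cb k l| ≤ M :=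
    ⟨max A B, fun k l => (hA k l).trans (le_max_left _ _), fun k l => by
      rw [abs_of_nonneg (hbnonneg k l)]
      exact (hB k l).trans (le_max_right _ _)⟩
  have hreg : ∀ m d, MeanRegular σs ca cb (jacobiPow ca cb m d) := by
    refine meanRegular_jacobiPow hs ⟨M, hMa⟩ ⟨M, hMb⟩ ((hNa 1 le_rfl).congr (hmean _))
      ((hNb 1 le_rfl).congr (hmean _)) fun la lb => ⟨Slim la lb, (hNs la lb).congr fun n => ?_⟩
    rw [← hmean]
    simp only [mul_assoc]
  have hlim : ∀ m, ∃ t, Tendsto (norlundMean σs (jacobiPow ca cb m 0)) atTop (nhds t) := by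
    intro m
    simpa using (hreg m 0).tendsto 0 0
  choose c hc using hlim
  have hdeg' : ∀ k l, (p k l).degree = l := fun k l => by
    rw [Polynomial.degree_eq_natDegree (Polynomial.leadingCoeff_ne_zero.1 (hlead k l).ne'), hdeg]
  have hrec' : ∀ k l x, x * (p k l).eval x = cb k (l + 1) * (p k (l + 1)).eval x +
      ca k l * (p k l).eval x + cb k l * (p k (l - 1)).eval x := fun k l x => by
    simpa using congrArg (Polynomial.eval x) (hrec k l)
  have hint : ∀ k {f : ℝ → ℝ}, Continuous f → Integrable f (μ k) := fun k f hf =>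
    have := hfin k
    integrable_of_continuous (hR k) hf
  have hNpos : ∀ n, 0 < N n := fun n => by
    rw [hN n]
    exact mul_pos (hτpos n) (Finset.sum_pos (fun k _ => inv_pos.2 (hτpos k)) (by simp))
  have hL : ∀ n, IsPositiveFunctionalOn (max |R| (3 * M)) fun f => ∑ k ∈ Finset.range (n + 1),
      σ n k * ∫ x, f x * ((p (n - k) k).eval x) ^ 2 ∂(μ (n - k)) := by
    refine fun n => ⟨fun f g hf hg => ?_, fun r f hf => ?_, fun f g hf hg h => ?_⟩
    · simp only [add_mul]
      rw [← Finset.sum_add_distrib]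
      refine Finset.sum_congr rfl fun k _ => ?_
      rw [integral_add (hint _ (by fun_prop)) (hint _ (by fun_prop)), mul_add]
    · simp only [mul_assoc, integral_const_mul, Finset.mul_sum]
      exact Finset.sum_congr rfl fun k _ => mul_left_comm _ _ _
    · refine Finset.sum_le_sum fun k hk => mul_le_mul_of_nonneg_left ?_
        (hσ0 n k (Nat.lt_succ_iff.1 (Finset.mem_range.1 hk)))
      refine integral_mono_ae (hint _ (by fun_prop)) (hint _ (by fun_prop)) ?_
      have hae : ∀ᵐ x ∂(μ (n - k)), x ∈ Set.Icc (-R) R := hR (n - k)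
      filter_upwards [hae] with x hx
      refine mul_le_mul_of_nonneg_right (h x (abs_le.1 ?_)) (sq_nonneg _)
      exact ((abs_le.2 hx).trans (le_abs_self R)).trans (le_max_left _ _)
  have hL' : ∀ n, IsPositiveFunctionalOn (max |R| (3 * M)) fun f => (1 / N n) *
      ∑ k ∈ Finset.range (n + 1), σ n k * ∑ j ∈ Finset.Icc 1 (k + 1), f (xr (n - k) (k + 1) j) := by
    refine fun n => ⟨fun f g hf hg => ?_, fun r f hf => ?_, fun f g hf hg h => ?_⟩
    · simp only [Finset.sum_add_distrib, mul_add]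
    · simp only [← Finset.mul_sum, mul_left_comm _ r]
    · refine mul_le_mul_of_nonneg_left (Finset.sum_le_sum fun k hk => ?_)
        (one_div_pos.2 (hNpos n)).le
      refine mul_le_mul_of_nonneg_left (Finset.sum_le_sum fun j hj => h _ (abs_le.1 ?_))
        (hσ0 n k (Nat.lt_succ_iff.1 (Finset.mem_range.1 hk)))
      obtain ⟨hj1, hj2⟩ := Finset.mem_Icc.1 hj
      exact (abs_root_le (hdeg' _) (hMa _) (hMb _) (hrec' _) (hroot _ k j hj1 hj2)).trans
        (le_max_right _ _)
  have hm : ∀ m : ℕ, Tendsto (fun n => ∑ k ∈ Finset.range (n + 1),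
      σ n k * ∫ x, x ^ m * ((p (n - k) k).eval x) ^ 2 ∂(μ (n - k))) atTop (nhds (c m)) := by
    refine fun m => (hc m).congr fun n => ?_
    rw [← hmean]
    refine Finset.sum_congr rfl fun k _ => ?_
    have := hfin (n - k)
    have h := integral_pow_mul_eq_jacobiPow (hR (n - k)) (horth (n - k)) (hb0 (n - k))
      (hrec' (n - k)) m k k
    rw [sub_self] at h
    simp only [← h, pow_two, mul_assoc]
  have htrace : ∀ m k n, ∑ j ∈ Finset.Icc 1 (n + 1), xr k (n + 1) j ^ m =
      ∑ i ∈ Finset.range (n + 1), truncatedPow (ca k) (cb k) (n + 1) m i i := by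
    intro m k n
    rw [← sum_pow_roots_eq_trace (hdeg' k) (hrec' k) (x := fun i => xr k (n + 1) (i + 1)) ?_
      (fun i => hroot k n _ (by omega) (by omega)) m,
      ← Finset.sum_range (fun i => xr k (n + 1) (i + 1) ^ m)]
    · rw [Finset.range_eq_Ico, Finset.sum_Ico_add' (fun i => xr k (n + 1) i ^ m) 0 (n + 1) 1]
      rfl
    · refine StrictMono.injective fun i i' h => hrootlt k n _ _ (by omega) ?_ (by omega)
      exact Nat.add_lt_add_right h 1
  have hm' : ∀ m : ℕ, Tendsto (fun n => (1 / N n) * ∑ k ∈ Finset.range (n + 1),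
      σ n k * ∑ j ∈ Finset.Icc 1 (k + 1), xr (n - k) (k + 1) j ^ m) atTop (nhds (c m)) := by
    intro m
    obtain ⟨C, hC⟩ := (hreg m 0).bounded
    have hmain := hs.tendsto_mean_partial_sums (hc m)
    have hzero : Tendsto (fun n => (N n)⁻¹ * (m * ((3 * M) ^ m + C))) atTop (nhds 0) := by
      simpa using hNinf.inv_tendsto_atTop.mul_const (m * ((3 * M) ^ m + C))
    have hdiff := squeeze_zero_norm (a := fun n => (N n)⁻¹ * (m * ((3 * M) ^ m + C)))
      (f := fun n => (N n)⁻¹ * ∑ k ∈ Finset.range (n + 1), σ n k *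
        (∑ j ∈ Finset.Icc 1 (k + 1), xr (n - k) (k + 1) j ^ m -
          ∑ i ∈ Finset.range (k + 1), jacobiPow ca cb m 0 (n - k) i)) (fun n => ?_) hzero
    · refine (zero_add (c m) ▸ hdiff.add hmain).congr fun n => ?_
      simp only [mul_sub, Finset.sum_sub_distrib]
      rw [one_div, sub_add_eq_add_sub, sub_eq_iff_eq_add]
      refine congrArg _ ?_
      rw [hN n, mul_inv, mul_comm (τ n)⁻¹, mul_assoc]
      simp only [hτ, inv_inv]
      refine congrArg _ ?_
      rw [Finset.mul_sum]
      refine Finset.sum_congr rfl fun k hk => ?_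
      rw [hfac n k (Nat.lt_succ_iff.1 (Finset.mem_range.1 hk)), hτ n, ← mul_assoc, ← mul_assoc,
        mul_inv_cancel₀ (hs.pos n).ne', one_mul]
    · rw [Real.norm_eq_abs, abs_mul, abs_of_pos (inv_pos.2 (hNpos n))]
      refine mul_le_mul_of_nonneg_left ?_ (inv_pos.2 (hNpos n)).le
      refine (Finset.abs_sum_le_sum_abs _ _).trans ?_
      calc _ ≤ ∑ k ∈ Finset.range (n + 1), σ n k * (m * ((3 * M) ^ m + C)) := by
            refine Finset.sum_le_sum fun k hk => ?_
            have h0 := hσ0 n k (Nat.lt_succ_iff.1 (Finset.mem_range.1 hk))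
            rw [abs_mul, abs_of_nonneg h0, htrace]
            exact mul_le_mul_of_nonneg_left (abs_sum_truncatedPow_sub_le (hb0 _) (hMa _) (hMb _)
              (hC _) _) h0
        _ = _ := by rw [← Finset.sum_mul, hσ1, one_mul]
  obtain ⟨ν, hν, h⟩ := IsPositiveFunctionalOn.exists_common_measure
    ((abs_nonneg R).trans (le_max_left _ _)) hL hL' hm hm'
  exact ⟨ν, hν, fun f hf _ => h f hf⟩
end

section
/- Let a ∈ ℝ, b > 0, and let the family (μ^(k)) be in the uniform Nevai class M^(U)(a,b). Let S be any regular Nörlund summation method with weights σ_{n,k} = τ_n σ_{n−k}, τ_n = (Σ_{j=0}^n σ_j)^{−1}, whose normalization constants N_n = τ_n Σ_{k=0}^n 1/τ_k tend to infinity. Then for every bounded continuous function f : ℝ → ℝ, lim_{n→∞} (1/N_n) Σ_{k=0}^n σ_{n,k} ∫_ℝ f(x) K_k^(n−k)(x,x) dμ^(n−k)(x) = (1/π) ∫_{a−2b}^{a+2b} f(x)/√(4b² − (x−a)²) dx, and lim_{n→∞} (1/N_n) Σ_{k=0}^n σ_{n,k} Σ_{j=1}^{k+1} f(x_{k+1,j}^(n−k))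 = (1/π) ∫_{a−2b}^{a+2b} f(x)/√(4b² − (x−a)²) dx, where x_{k+1,j}^(n−k) are the roots of p_{k+1}^(n−k). -/
open Filter MeasureTheory

/-- Regular averages of a sequence that converges uniformly in a parameter. -/
lemma tendsto_regular_average {α : Type*} {F : Filter α} {U : ℕ × ℕ → ℝ} {c B : ℝ}
    (hU : Tendsto U (comap Prod.fst atTop) (nhds c)) (hB : ∀ q, |U q| ≤ B)
    {w : α → ℕ → ℝ} {ν : α → ℕ} (hw₀ : ∀ᶠ i in F, ∀ k ∈ Finset.range (ν i), 0 ≤ w i k)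
    (hw₁ : ∀ᶠ i in F, ∑ k ∈ Finset.range (ν i), w i k = 1)
    (hw : ∀ k, Tendsto (fun i => w i k) F (nhds 0)) (κ : α → ℕ → ℕ) :
    Tendsto (fun i => ∑ k ∈ Finset.range (ν i), w i k * U (k, κ i k)) F (nhds c) := by
  rw [Metric.tendsto_nhds]
  intro ε hε
  have h1 := (Metric.tendsto_nhds.1 hU) (ε / 2) (by positivity)
  rw [eventually_comap, eventually_atTop] at h1
  obtain ⟨K, hK⟩ := h1
  have h2 : Tendsto (fun i => (B + |c|) * ∑ k ∈ Finset.range K, |w i k|) F (nhds 0) := by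
    have h3 : Tendsto (fun i => ∑ k ∈ Finset.range K, |w i k|) F
        (nhds (∑ k ∈ Finset.range K, |(0 : ℝ)|)) :=
      tendsto_finsetSum _ fun k _ => (hw k).abs
    simpa using h3.const_mul (B + |c|)
  have h3 := h2.eventually_lt_const (half_pos hε)
  filter_upwards [hw₀, hw₁, h3] with i h₀ h₁ h₃
  have hBc : 0 ≤ B + |c| := by linarith [abs_nonneg (U (0, 0)), hB (0, 0), abs_nonneg c]
  have hrw : ∑ k ∈ Finset.range (ν i), w i k * U (k, κ i k) - c
      = ∑ k ∈ Finset.range (ν i), w i k * (U (k, κ i k) - c) := by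
    simp only [mul_sub, Finset.sum_sub_distrib, ← Finset.sum_mul, h₁, one_mul]
  rw [Real.dist_eq, hrw]
  calc |∑ k ∈ Finset.range (ν i), w i k * (U (k, κ i k) - c)|
      ≤ ∑ k ∈ Finset.range (ν i), |w i k * (U (k, κ i k) - c)| := Finset.abs_sum_le_sum_abs _ _
    _ ≤ ∑ k ∈ Finset.range (ν i), (w i k * (ε / 2) +
          if k < K then (B + |c|) * |w i k| else 0) := by
        refine Finset.sum_le_sum fun k hk => ?_
        have hwk := h₀ k hk
        rw [abs_mul, abs_of_nonneg hwk]
        split_ifs with hkK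
        · have : |U (k, κ i k) - c| ≤ B + |c| :=
            (abs_sub _ _).trans (add_le_add (hB _) le_rfl)
          nlinarith [mul_le_mul_of_nonneg_left this hwk, mul_nonneg hwk hε.le]
        · have := hK k (not_lt.1 hkK) (k, κ i k) rfl
          rw [Real.dist_eq] at this
          simpa using mul_le_mul_of_nonneg_left this.le hwk
    _ ≤ ε / 2 + (B + |c|) * ∑ k ∈ Finset.range K, |w i k| := by
        rw [Finset.sum_add_distrib, ← Finset.sum_mul, h₁, one_mul, ← Finset.sum_filter,
          ← Finset.mul_sum]
        gcongr
        intro k hk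
        simp only [Finset.mem_filter] at hk
        exact Finset.mem_range.2 hk.2
    _ < ε := by linarith

lemma tendsto_uniform_cesaro {U : ℕ × ℕ → ℝ} {c B : ℝ}
    (hU : Tendsto U (comap Prod.fst atTop) (nhds c)) (hB : ∀ q, |U q| ≤ B) :
    Tendsto (fun q : ℕ × ℕ => ((q.1 : ℝ) + 1)⁻¹ * ∑ l ∈ Finset.range (q.1 + 1), U (l, q.2))
      (comap Prod.fst atTop) (nhds c) := by
  have h := tendsto_regular_average (F := comap Prod.fst atTop) hU hB
    (w := fun (q : ℕ × ℕ) _ => ((q.1 : ℝ) + 1)⁻¹) (ν := fun q : ℕ × ℕ => q.1 + 1)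
    (Eventually.of_forall fun q k _ => by positivity)
    (Eventually.of_forall fun q => by
      simp only [Finset.sum_const, Finset.card_range, nsmul_eq_mul]
      push_cast
      exact mul_inv_cancel₀ (by positivity))
    (fun k => by
      have : Tendsto (fun n : ℕ => ((n : ℝ) + 1)⁻¹) atTop (nhds 0) := by
        simpa using tendsto_one_div_add_atTop_nhds_zero_nat (𝕜 := ℝ)
      exact this.comp tendsto_comap) (fun q _ => q.2)
  simpa only [Finset.mul_sum] using h

/-- Moments determine limits of functionals that are uniformly bounded on a compact interval. -/
lemma tendsto_of_tendsto_pow {α : Type*} {F : Filter α} {A : ℝ}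
    {Φ : α → C(ℝ, ℝ) →ₗ[ℝ] ℝ} {Ψ : C(ℝ, ℝ) →ₗ[ℝ] ℝ}
    (hΦ : ∀ i (f : C(ℝ, ℝ)) (ε : ℝ), (∀ x, |x| ≤ A → |f x| ≤ ε) → |Φ i f| ≤ ε)
    (hΨ : ∀ (f : C(ℝ, ℝ)) (ε : ℝ), (∀ x, |x| ≤ A → |f x| ≤ ε) → |Ψ f| ≤ ε)
    (hpow : ∀ m : ℕ, Tendsto (fun i => Φ i (ContinuousMap.id ℝ ^ m)) F
      (nhds (Ψ (ContinuousMap.id ℝ ^ m)))) (f : C(ℝ, ℝ)) :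
    Tendsto (fun i => Φ i f) F (nhds (Ψ f)) := by
  have hpoly : ∀ q : Polynomial ℝ, Tendsto (fun i => Φ i q.toContinuousMap) F
      (nhds (Ψ q.toContinuousMap)) := by
    intro q
    induction q using Polynomial.induction_on' with
    | add q r hq hr =>
      have : (q + r).toContinuousMap = q.toContinuousMap + r.toContinuousMap := by
        ext x; simp
      simp only [this, map_add]
      exact hq.add hr
    | monomial n t =>
      have : (Polynomial.monomial n t).toContinuousMap = t • ContinuousMap.id ℝ ^ n := by
        ext x; simp
      simp only [this, map_smul]
      exact (hpow n).const_smul t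
  rw [Metric.tendsto_nhds]
  intro ε hε
  obtain ⟨q, hq⟩ := exists_polynomial_near_of_continuousOn (-A) A f
    f.continuous.continuousOn (ε / 3) (by positivity)
  have hq' : ∀ x, |x| ≤ A → |(q.toContinuousMap - f) x| ≤ ε / 3 := fun x hx => by
    simpa using (hq x (abs_le.1 hx)).le
  filter_upwards [(Metric.tendsto_nhds.1 (hpoly q)) (ε / 3) (by positivity)] with i hi
  have h1 := hΦ i _ _ hq'
  have h2 := hΨ _ _ hq'
  rw [map_sub] at h1 h2
  rw [Real.dist_eq] at hi ⊢
  rw [abs_le] at h1 h2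
  rw [abs_lt] at hi ⊢
  constructor <;> linarith

/-- The functional of the arcsine distribution on `[a - 2 * b, a + 2 * b]`. -/
noncomputable def arcsineFunctional (a b : ℝ) : C(ℝ, ℝ) →ₗ[ℝ] ℝ where
  toFun f := (1 / Real.pi) * ∫ t in (0 : ℝ)..Real.pi, f (a + 2 * b * Real.cos t)
  map_add' f g := by
    simp only [ContinuousMap.add_apply]
    rw [intervalIntegral.integral_add, mul_add] <;>
      exact Continuous.intervalIntegrable (by fun_prop) _ _
  map_smul' r f := by
    simp only [ContinuousMap.smul_apply, smul_eq_mul, RingHom.id_apply,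
      intervalIntegral.integral_const_mul]
    ring

lemma arcsineFunctional_apply (a b : ℝ) (f : C(ℝ, ℝ)) : arcsineFunctional a b f =
    (1 / Real.pi) * ∫ t in (0 : ℝ)..Real.pi, f (a + 2 * b * Real.cos t) := rfl

lemma abs_arcsineFunctional_le {a b A : ℝ} (hA : |a| + 2 * |b| ≤ A) (f : C(ℝ, ℝ)) (ε : ℝ)
    (hf : ∀ x, |x| ≤ A → |f x| ≤ ε) : |arcsineFunctional a b f| ≤ ε := by
  have h := intervalIntegral.norm_integral_le_of_norm_le_const (a := 0) (b := Real.pi)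
    (f := fun t => f (a + 2 * b * Real.cos t)) (C := ε) fun t _ => by
      refine hf _ (le_trans ((abs_add_le _ _).trans ?_) hA)
      rw [abs_mul, abs_mul, abs_two]
      nlinarith [Real.abs_cos_le_one t, abs_nonneg b]
  rw [Real.norm_eq_abs, sub_zero, abs_of_pos Real.pi_pos] at h
  rw [arcsineFunctional_apply, abs_mul, abs_of_pos (by positivity : 0 < 1 / Real.pi),
    one_div, inv_mul_le_iff₀ Real.pi_pos]
  linarith

lemma arcsineFunctional_eq_integral {a b : ℝ} (hb : 0 < b) (f : C(ℝ, ℝ)) :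
    arcsineFunctional a b f = (1 / Real.pi) * ∫ x in (a - 2 * b)..(a + 2 * b),
      f x / Real.sqrt (4 * b ^ 2 - (x - a) ^ 2) := by
  rw [arcsineFunctional_apply]
  congr 1
  rw [intervalIntegral.integral_of_le Real.pi_pos.le, integral_Ioc_eq_integral_Ioo,
    intervalIntegral.integral_of_le (by linarith), integral_Ioc_eq_integral_Ioo]
  have himg : (fun t => a + 2 * b * Real.cos t) '' Set.Ioo 0 Real.pi
      = Set.Ioo (a - 2 * b) (a + 2 * b) := by
    ext x
    simp only [Set.mem_image, Set.mem_Ioo]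
    constructor
    · rintro ⟨t, ht, rfl⟩
      have h1 : Real.cos t < 1 := by
        simpa using Real.cos_lt_cos_of_nonneg_of_le_pi le_rfl ht.2.le ht.1
      have h2 : -1 < Real.cos t := by
        simpa using Real.cos_lt_cos_of_nonneg_of_le_pi ht.1.le le_rfl ht.2
      constructor <;> nlinarith
    · rintro ⟨h1, h2⟩
      have h3 : -1 < (x - a) / (2 * b) := by rw [lt_div_iff₀ (by positivity)]; linarith
      have h4 : (x - a) / (2 * b) < 1 := by rw [div_lt_iff₀ (by positivity)]; linarith
      refine ⟨Real.arccos ((x - a) / (2 * b)), ⟨Real.arccos_pos.2 h4, ?_⟩, ?_⟩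
      · exact lt_of_le_of_ne (Real.arccos_le_pi _) fun h => by
          linarith [Real.arccos_eq_pi.1 h]
      · rw [Real.cos_arccos h3.le h4.le]
        field_simp
        ring
  rw [← himg, integral_image_eq_integral_abs_deriv_smul
    (f' := fun t => 2 * b * -Real.sin t) measurableSet_Ioo]
  · refine setIntegral_congr_fun measurableSet_Ioo fun t ht => ?_
    have hs := Real.sin_pos_of_mem_Ioo ht
    have h1 : 4 * b ^ 2 - (a + 2 * b * Real.cos t - a) ^ 2 = (2 * b * Real.sin t) ^ 2 := by
      nlinarith [Real.sin_sq_add_cos_sq t]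
    have h2 : |2 * b * -Real.sin t| = 2 * b * Real.sin t := by
      rw [mul_neg, abs_neg, abs_of_pos (by positivity)]
    simp only [h1, h2, smul_eq_mul]
    rw [Real.sqrt_sq (by positivity)]
    field_simp
  · intro t _
    exact (((Real.hasDerivAt_cos t).const_mul (2 * b)).const_add a).hasDerivWithinAt
  · intro s hs t ht hst
    refine Real.injOn_cos (Set.Ioo_subset_Icc_self hs) (Set.Ioo_subset_Icc_self ht) ?_
    have : 2 * b * Real.cos s = 2 * b * Real.cos t := by simpa using hst
    exact mul_left_cancel₀ (by positivity) this

/-- Fourier-type moments of the arcsine distribution. -/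
noncomputable def arcsineMoment (a b : ℝ) (m : ℕ) (d : ℤ) : ℝ :=
  (1 / Real.pi) * ∫ t in (0 : ℝ)..Real.pi, (a + 2 * b * Real.cos t) ^ m * Real.cos (d * t)

lemma arcsineMoment_zero_left (a b : ℝ) (d : ℤ) :
    arcsineMoment a b 0 d = if d = 0 then 1 else 0 := by
  unfold arcsineMoment
  split_ifs with h
  · simp [h, Real.pi_ne_zero]
  · have hd : (d : ℝ) ≠ 0 := by exact_mod_cast h
    simp [intervalIntegral.integral_comp_mul_left (fun t => Real.cos t) hd, integral_cos,
      Real.sin_int_mul_pi]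

lemma arcsineMoment_succ (a b : ℝ) (m : ℕ) (d : ℤ) :
    arcsineMoment a b (m + 1) d = b * arcsineMoment a b m (d - 1) + a * arcsineMoment a b m d
      + b * arcsineMoment a b m (d + 1) := by
  unfold arcsineMoment
  have hi : ∀ e : ℤ, IntervalIntegrable
      (fun t => (a + 2 * b * Real.cos t) ^ m * Real.cos (e * t)) volume 0 Real.pi :=
    fun e => Continuous.intervalIntegrable (by fun_prop) _ _
  have h : ∀ t : ℝ, (a + 2 * b * Real.cos t) ^ (m + 1) * Real.cos (d * t)
      = (b * ((a + 2 * b * Real.cos t) ^ m * Real.cos ((d - 1 : ℤ) * t))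
        + a * ((a + 2 * b * Real.cos t) ^ m * Real.cos (d * t)))
        + b * ((a + 2 * b * Real.cos t) ^ m * Real.cos ((d + 1 : ℤ) * t)) := by
    intro t
    push_cast
    rw [sub_mul, add_mul, one_mul, Real.cos_sub, Real.cos_add]
    ring
  simp only [h]
  rw [intervalIntegral.integral_add (((hi _).const_mul _).add ((hi _).const_mul _))
    ((hi _).const_mul _), intervalIntegral.integral_add ((hi _).const_mul _) ((hi _).const_mul _)]
  simp only [intervalIntegral.integral_const_mul]
  ring

/-- `p` is the orthonormal system of `μ`, which lives on `[-R, R]`, with Jacobi coefficients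
`a` (diagonal) and `b` (off-diagonal). -/
structure IsJacobiSystem (R : ℝ) (μ : Measure ℝ) (p : ℕ → Polynomial ℝ) (a b : ℕ → ℝ) : Prop where
  finite : IsFiniteMeasure μ
  supp : ∀ᵐ x ∂μ, |x| ≤ R
  natDegree (l : ℕ) : (p l).natDegree = l
  orth (l m : ℕ) : (∫ x, (p l).eval x * (p m).eval x ∂μ) = if l = m then 1 else 0
  zero : b 0 = 0
  recurrence (l : ℕ) (x : ℝ) : x * (p l).eval x =
    b (l + 1) * (p (l + 1)).eval x + a l * (p l).eval x + b l * (p (l - 1)).eval x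

namespace IsJacobiSystem

variable {R : ℝ} {μ : Measure ℝ} {p : ℕ → Polynomial ℝ} {a b : ℕ → ℝ}

lemma integrable (h : IsJacobiSystem R μ p a b) {f : ℝ → ℝ} (hf : Continuous f) :
    Integrable f μ := by
  have := h.finite
  obtain ⟨C, hC⟩ := (isCompact_Icc (a := -R) (b := R)).exists_bound_of_continuousOn hf.continuousOn
  refine Integrable.of_bound hf.aestronglyMeasurable C ?_
  filter_upwards [h.supp] with x hx
  exact hC x (abs_le.1 hx)

/-- The functional `f ↦ ∫ f p_l² dμ`. -/
noncomputable def functional (h : IsJacobiSystem R μ p a b) (l : ℕ) : C(ℝ, ℝ) →ₗ[ℝ] ℝ where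
  toFun f := ∫ x, f x * (p l).eval x ^ 2 ∂μ
  map_add' f g := by
    simp only [ContinuousMap.add_apply, add_mul]
    exact integral_add (h.integrable (by fun_prop)) (h.integrable (by fun_prop))
  map_smul' r f := by
    simp only [ContinuousMap.smul_apply, smul_eq_mul, RingHom.id_apply, mul_assoc]
    exact integral_const_mul _ _

lemma functional_apply (h : IsJacobiSystem R μ p a b) (l : ℕ) (f : C(ℝ, ℝ)) :
    h.functional l f = ∫ x, f x * (p l).eval x ^ 2 ∂μ := rfl

lemma integral_sq (h : IsJacobiSystem R μ p a b) (l : ℕ) : ∫ x, (p l).eval x ^ 2 ∂μ = 1 := by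
  simpa [sq] using h.orth l l

lemma abs_functional_le (h : IsJacobiSystem R μ p a b) (l : ℕ) {f : C(ℝ, ℝ)} {ε : ℝ}
    (hf : ∀ x, |x| ≤ R → |f x| ≤ ε) : |h.functional l f| ≤ ε := by
  have h1 := norm_integral_le_of_norm_le (μ := μ) (f := fun x => f x * (p l).eval x ^ 2)
    (g := fun x => ε * (p l).eval x ^ 2) (h.integrable (by fun_prop)) (by
      filter_upwards [h.supp] with x hx
      rw [norm_mul, Real.norm_eq_abs, Real.norm_eq_abs, abs_of_nonneg (sq_nonneg (Polynomial.eval x _))]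
      exact mul_le_mul_of_nonneg_right (hf x hx) (sq_nonneg _))
  rwa [integral_const_mul, h.integral_sq, mul_one] at h1

/-- The matrix entry `(l, i)` of the `m`-th power of the Jacobi matrix. -/
noncomputable def moment (μ : Measure ℝ) (p : ℕ → Polynomial ℝ) (i m l : ℕ) : ℝ :=
  ∫ x, x ^ m * (p l).eval x * (p i).eval x ∂μ

lemma moment_zero (h : IsJacobiSystem R μ p a b) (i l : ℕ) :
    moment μ p i 0 l = if l = i then 1 else 0 := by
  simpa [moment] using h.orth l i

lemma moment_succ (h : IsJacobiSystem R μ p a b) (i m l : ℕ) :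
    moment μ p i (m + 1) l = b (l + 1) * moment μ p i m (l + 1) + a l * moment μ p i m l
      + b l * moment μ p i m (l - 1) := by
  unfold moment
  rw [← integral_const_mul, ← integral_const_mul, ← integral_const_mul,
    ← integral_add (h.integrable (by fun_prop)) (h.integrable (by fun_prop)),
    ← integral_add (h.integrable (by fun_prop)) (h.integrable (by fun_prop))]
  congr 1
  ext x
  have := h.recurrence l x
  linear_combination x ^ m * (p i).eval x * this

lemma functional_pow (h : IsJacobiSystem R μ p a b) (m l : ℕ) :
    h.functional l (ContinuousMap.id ℝ ^ m) = moment μ p l m l := by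
  simp [functional_apply, moment, sq, mul_assoc]

lemma abs_moment_one_le (h : IsJacobiSystem R μ p a b) (i l : ℕ) : |moment μ p i 1 l| ≤ R := by
  have h1 := norm_integral_le_of_norm_le (μ := μ)
    (f := fun x => x ^ 1 * (p l).eval x * (p i).eval x)
    (g := fun x => R / 2 * (p l).eval x ^ 2 + R / 2 * (p i).eval x ^ 2)
    (h.integrable (by fun_prop)) (by
      filter_upwards [h.supp] with x hx
      rw [mul_assoc, pow_one, norm_mul, norm_mul, Real.norm_eq_abs, Real.norm_eq_abs,
        Real.norm_eq_abs]
      have h2 := two_mul_le_add_sq |(p l).eval x| |(p i).eval x|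
      rw [sq_abs, sq_abs] at h2
      calc |x| * (|(p l).eval x| * |(p i).eval x|)
          ≤ R * (|(p l).eval x| * |(p i).eval x|) := by gcongr
        _ ≤ _ := by nlinarith [abs_nonneg x])
  rw [integral_add (h.integrable (by fun_prop)) (h.integrable (by fun_prop)), integral_const_mul,
    integral_const_mul, h.integral_sq, h.integral_sq] at h1
  rw [moment]
  rw [Real.norm_eq_abs] at h1
  linarith

lemma nonneg (h : IsJacobiSystem R μ p a b) : 0 ≤ R :=
  (abs_nonneg _).trans (h.abs_moment_one_le 0 0)

lemma abs_diag_le (h : IsJacobiSystem R μ p a b) (l : ℕ) : |a l| ≤ R := by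
  have h1 := h.abs_moment_one_le l l
  rw [h.moment_succ, h.moment_zero, h.moment_zero, h.moment_zero] at h1
  rcases l with _ | l <;> simpa [h.zero] using h1

lemma abs_offDiag_le (h : IsJacobiSystem R μ p a b) (l : ℕ) : |b l| ≤ R := by
  rcases l with _ | l
  · simpa [h.zero] using h.nonneg
  have h1 := h.abs_moment_one_le (l + 1) l
  rw [h.moment_succ, h.moment_zero, h.moment_zero, h.moment_zero] at h1
  have h2 : l - 1 ≠ l + 1 := by omega
  simpa [h2] using h1

/-- Roots of the orthonormal polynomials are bounded (Gershgorin). -/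
lemma abs_root_le (h : IsJacobiSystem R μ p a b) {n : ℕ} {y : ℝ} (hy : (p (n + 1)).eval y = 0) :
    |y| ≤ 3 * R := by
  obtain ⟨i, hi, hmax⟩ := Finset.exists_max_image (Finset.range (n + 1))
    (fun l => |(p l).eval y|) ⟨0, by simp⟩
  rw [Finset.mem_range] at hi
  have hp0 : (p 0).eval y ≠ 0 := by
    intro h0
    have h1 : ∀ x, (p 0).eval x = 0 := fun x => by
      rw [Polynomial.eq_C_of_natDegree_eq_zero (h.natDegree 0)] at h0 ⊢
      simpa using h0
    have h2 := h.integral_sq 0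
    simp [h1] at h2
  have hpos : 0 < |(p i).eval y| :=
    (abs_pos.2 hp0).trans_le (hmax 0 (by simp))
  have hle : ∀ l ≤ n + 1, |(p l).eval y| ≤ |(p i).eval y| := by
    intro l hl
    rcases hl.lt_or_eq with hl | rfl
    · exact hmax l (by simpa using hl)
    · simp [hy]
  have h1 : ∀ c l, |c| ≤ R → l ≤ n + 1 → |c * (p l).eval y| ≤ R * |(p i).eval y| :=
    fun c l hc hl => by
      rw [abs_mul]
      exact mul_le_mul hc (hle l hl) (abs_nonneg _) h.nonneg
  have h2 : |y| * |(p i).eval y| ≤ 3 * R * |(p i).eval y| := by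
    rw [← abs_mul, h.recurrence]
    refine (abs_add_three _ _ _).trans ?_
    linarith [h1 _ (i + 1) (h.abs_offDiag_le (i + 1)) (by omega),
      h1 _ i (h.abs_diag_le i) (by omega), h1 _ (i - 1) (h.abs_offDiag_le i) (by omega)]
  exact le_of_mul_le_mul_right h2 hpos

/-- The entries of powers of a Jacobi matrix and of its truncations agree far from the corner. -/
lemma eq_of_jacobi_recurrence {u v : ℕ → ℕ → ℝ} {n : ℕ}
    (hu : ∀ m l, l ≤ n → u (m + 1) l = b (l + 1) * u m (l + 1) + a l * u m l + b l * u m (l - 1))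
    (hv : ∀ m l, l ≤ n → v (m + 1) l = b (l + 1) * v m (l + 1) + a l * v m l + b l * v m (l - 1))
    (h₀ : ∀ l ≤ n, u 0 l = v 0 l) (m : ℕ) : ∀ l, l + m ≤ n → u m l = v m l := by
  induction m with
  | zero => exact fun l hl => h₀ l (by omega)
  | succ m ih =>
    intro l hl
    rw [hu m l (by omega), hv m l (by omega), ih (l + 1) (by omega), ih l (by omega),
      ih (l - 1) (by omega)]

lemma abs_le_of_jacobi_recurrence {u : ℕ → ℕ → ℝ} {n : ℕ} (hR : 0 ≤ R)
    (ha : ∀ l, |a l| ≤ R) (hb : ∀ l, |b l| ≤ R)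
    (hu : ∀ m l, l ≤ n → u (m + 1) l = b (l + 1) * u m (l + 1) + a l * u m l + b l * u m (l - 1))
    (hu₁ : ∀ m, u m (n + 1) = 0) (h₀ : ∀ l ≤ n, |u 0 l| ≤ 1) (m : ℕ) :
    ∀ l ≤ n + 1, |u m l| ≤ (3 * R) ^ m := by
  induction m with
  | zero =>
    intro l hl
    rcases hl.lt_or_eq with hl | rfl
    · simpa using h₀ l (by omega)
    · simp [hu₁]
  | succ m ih =>
    intro l hl
    rcases hl.lt_or_eq with hl | rfl
    · have h1 : ∀ c l, |c| ≤ R → l ≤ n + 1 → |c * u m l| ≤ R * (3 * R) ^ m :=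
        fun c l hc hl => by
          rw [abs_mul]
          exact mul_le_mul hc (ih l hl) (abs_nonneg _) hR
      rw [hu m l (by omega), pow_succ']
      refine (abs_add_three _ _ _).trans ?_
      linarith [h1 _ (l + 1) (hb (l + 1)) (by omega), h1 _ l (ha l) (by omega),
        h1 _ (l - 1) (hb l) (by omega)]
    · rw [hu₁, abs_zero]
      positivity

/-- The matrix of polynomial values at the roots of `p_{n+1}` has an explicit inverse. -/
lemma exists_inverse (h : IsJacobiSystem R μ p a b) {n : ℕ} {y : Fin (n + 1) → ℝ}
    (hy : Function.Injective y) : ∃ W : Fin (n + 1) → Fin (n + 1) → ℝ,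
      (∀ i l, ∑ j, W i j * (p (l : Fin (n + 1))).eval (y j) = if i = l then 1 else 0) ∧
      ∀ j, ∑ l : Fin (n + 1), (p l).eval (y j) * W l j = 1 := by
  classical
  let W : Matrix (Fin (n + 1)) (Fin (n + 1)) ℝ := fun i j =>
    ∫ x, (Lagrange.basis Finset.univ y j).eval x * (p i).eval x ∂μ
  let V : Matrix (Fin (n + 1)) (Fin (n + 1)) ℝ := fun j l => (p l).eval (y j)
  have hWV : ∀ i l, ∑ j, W i j * V j l = if i = l then 1 else 0 := by
    intro i l
    have h1 : p l = ∑ j, Polynomial.C ((p l).eval (y j)) * Lagrange.basis Finset.univ y j := by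
      conv_lhs => rw [Lagrange.eq_interpolate (s := Finset.univ) (v := y) (f := p l)
        hy.injOn (by
          refine (Polynomial.degree_le_natDegree).trans_lt ?_
          rw [h.natDegree]
          simp only [Finset.card_univ, Fintype.card_fin]
          exact_mod_cast l.2)]
      rw [Lagrange.interpolate_apply]
    have h2 := h.orth l i
    have h3 : ∀ x, (p l).eval x * (p i).eval x = ∑ j, (p l).eval (y j) *
        ((Lagrange.basis Finset.univ y j).eval x * (p i).eval x) := fun x => by
      conv_lhs => rw [h1]
      simp only [Polynomial.eval_finsetSum, Polynomial.eval_mul, Polynomial.eval_C,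
        Finset.sum_mul, mul_assoc]
    simp only [h3] at h2
    rw [integral_finsetSum _ fun j _ => h.integrable (by fun_prop)] at h2
    simp only [integral_const_mul] at h2
    simp only [mul_comm (W i _), Fin.ext_iff, eq_comm (a := (i : ℕ))]
    exact h2
  refine ⟨W, hWV, fun j => ?_⟩
  have h1 : W * V = 1 := by
    ext i l
    rw [Matrix.mul_apply, hWV, Matrix.one_apply]
  have h2 : V * W = 1 := mul_eq_one_comm.1 h1
  have h3 := congrFun (congrFun h2 j) j
  rwa [Matrix.mul_apply, Matrix.one_apply_eq] at h3

/-- Power sums of the roots of `p_{n+1}` compared with partial traces of the Jacobi matrix. -/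
lemma abs_sum_root_pow_sub_le (h : IsJacobiSystem R μ p a b) {n : ℕ} {y : Fin (n + 1) → ℝ}
    (hy : Function.Injective y) (hroot : ∀ j, (p (n + 1)).eval (y j) = 0) (m : ℕ) :
    |∑ j, y j ^ m - ∑ l ∈ Finset.range (n + 1), moment μ p l m l| ≤ m * (2 * (3 * R) ^ m) := by
  obtain ⟨W, hWV, hVW⟩ := h.exists_inverse hy
  let s : Fin (n + 1) → ℕ → ℕ → ℝ := fun i m l => ∑ j, W i j * (y j ^ m * (p l).eval (y j))
  have hs : ∀ i m l, s i (m + 1) l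
      = b (l + 1) * s i m (l + 1) + a l * s i m l + b l * s i m (l - 1) := by
    intro i m l
    simp only [s, Finset.mul_sum, ← Finset.sum_add_distrib]
    refine Finset.sum_congr rfl fun j _ => ?_
    linear_combination W i j * y j ^ m * h.recurrence l (y j)
  have hs₀ : ∀ i l, l ≤ n → s i 0 l = if l = i then 1 else 0 := by
    intro i l hl
    have := hWV i ⟨l, by omega⟩
    simpa [s, Fin.ext_iff, eq_comm (a := (i : ℕ))] using this
  have hs₁ : ∀ i m, s i m (n + 1) = 0 := fun i m => by simp [s, hroot]
  have htr : ∑ j, y j ^ m = ∑ l : Fin (n + 1), s l m l := by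
    simp only [s]
    rw [Finset.sum_comm]
    refine Finset.sum_congr rfl fun j _ => ?_
    calc y j ^ m = y j ^ m * ∑ l : Fin (n + 1), (p l).eval (y j) * W l j := by
          rw [hVW, mul_one]
      _ = _ := by
          rw [Finset.mul_sum]
          exact Finset.sum_congr rfl fun l _ => by ring
  have heq : ∀ l : Fin (n + 1), (l : ℕ) + m ≤ n → s l m l = moment μ p l m l := fun l hl =>
    eq_of_jacobi_recurrence (fun m k _ => hs l m k) (fun m k _ => h.moment_succ l m k)
      (fun k hk => by rw [hs₀ l k hk, h.moment_zero]) m l hl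
  have hle₁ : ∀ l : Fin (n + 1), |s l m l| ≤ (3 * R) ^ m := fun l =>
    abs_le_of_jacobi_recurrence h.nonneg h.abs_diag_le h.abs_offDiag_le (fun m k _ => hs l m k)
      (hs₁ l) (fun k hk => by rw [hs₀ l k hk]; split_ifs <;> simp) m l (by omega)
  have hle₂ : ∀ l, |moment μ p l m l| ≤ (3 * R) ^ m := fun l => by
    rw [← h.functional_pow]
    refine h.abs_functional_le l fun x hx => ?_
    simp only [ContinuousMap.pow_apply, ContinuousMap.id_apply, abs_pow]
    have := h.nonneg
    exact pow_le_pow_left₀ (abs_nonneg _) (by linarith) m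
  have hcard : ((Finset.range (n + 1)).filter fun l => n < l + m).card ≤ m := by
    refine (Finset.card_le_card (t := Finset.Ico (n + 1 - m) (n + 1)) fun l hl => ?_).trans ?_
    · simp only [Finset.mem_filter, Finset.mem_range, Finset.mem_Ico] at hl ⊢
      omega
    · simp only [Nat.card_Ico]; omega
  have hR := h.nonneg
  rw [htr, Finset.sum_range, ← Finset.sum_sub_distrib]
  calc |∑ l : Fin (n + 1), (s l m l - moment μ p l m l)|
      ≤ ∑ l : Fin (n + 1), |s l m l - moment μ p l m l| := Finset.abs_sum_le_sum_abs _ _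
    _ ≤ ∑ l : Fin (n + 1), if n < (l : ℕ) + m then 2 * (3 * R) ^ m else 0 := by
        refine Finset.sum_le_sum fun l _ => ?_
        split_ifs with hl
        · linarith [abs_sub (s l m l) (moment μ p l m l), hle₁ l, hle₂ l]
        · rw [heq l (not_lt.1 hl), sub_self, abs_zero]
    _ = (((Finset.range (n + 1)).filter fun l => n < l + m).card : ℝ) * (2 * (3 * R) ^ m) := by
        rw [← Finset.sum_range (fun l => if n < l + m then 2 * (3 * R) ^ m else 0),
          ← Finset.sum_filter, Finset.sum_const, nsmul_eq_mul]
    _ ≤ m * (2 * (3 * R) ^ m) := by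
        have : (((Finset.range (n + 1)).filter fun l => n < l + m).card : ℝ) ≤ m := by
          exact_mod_cast hcard
        gcongr

end IsJacobiSystem

section Family

variable {R : ℝ} {μ : ℕ → Measure ℝ} {p : ℕ → ℕ → Polynomial ℝ} {a b : ℕ → ℕ → ℝ} {a₀ b₀ : ℝ}

open IsJacobiSystem

lemma tendsto_moment (h : ∀ k, IsJacobiSystem R (μ k) (p k) (a k) (b k))
    (ha : Tendsto (fun q : ℕ × ℕ => a q.2 q.1) (comap Prod.fst atTop) (nhds a₀))
    (hb : Tendsto (fun q : ℕ × ℕ => b q.2 q.1) (comap Prod.fst atTop) (nhds b₀)) (m : ℕ) :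
    ∀ d : ℤ, Tendsto (fun q : ℕ × ℕ => moment (μ q.2) (p q.2) (q.1 + d).toNat m q.1)
      (comap Prod.fst atTop) (nhds (arcsineMoment a₀ b₀ m d)) := by
  have hlarge : ∀ n : ℕ, ∀ᶠ q : ℕ × ℕ in comap Prod.fst atTop, n ≤ q.1 := fun n =>
    tendsto_comap.eventually (eventually_ge_atTop n)
  induction m with
  | zero =>
    intro d
    refine tendsto_const_nhds.congr' ?_
    filter_upwards [hlarge d.natAbs] with q hq
    rw [(h q.2).moment_zero, arcsineMoment_zero_left]
    exact if_congr (by omega) rfl rfl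
  | succ m ih =>
    intro d
    have hup : Tendsto (fun q : ℕ × ℕ => (q.1 + 1, q.2)) (comap Prod.fst atTop)
        (comap Prod.fst atTop) :=
      tendsto_comap_iff.2 ((tendsto_add_atTop_nat 1).comp tendsto_comap)
    have hdown : Tendsto (fun q : ℕ × ℕ => (q.1 - 1, q.2)) (comap Prod.fst atTop)
        (comap Prod.fst atTop) :=
      tendsto_comap_iff.2 ((tendsto_sub_atTop_nat 1).comp tendsto_comap)
    have h1 := (((hb.comp hup).mul ((ih (d - 1)).comp hup)).add (ha.mul (ih d))).add
      (hb.mul ((ih (d + 1)).comp hdown))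
    rw [arcsineMoment_succ]
    refine h1.congr' ?_
    filter_upwards [hlarge 1] with q hq
    have e1 : (((q.1 + 1 : ℕ) : ℤ) + (d - 1)).toNat = ((q.1 : ℤ) + d).toNat := by omega
    have e2 : (((q.1 - 1 : ℕ) : ℤ) + (d + 1)).toNat = ((q.1 : ℤ) + d).toNat := by omega
    simp only [Function.comp_apply, e1, e2]
    rw [(h q.2).moment_succ]

lemma tendsto_functional_average (h : ∀ k, IsJacobiSystem R (μ k) (p k) (a k) (b k))
    (ha : Tendsto (fun q : ℕ × ℕ => a q.2 q.1) (comap Prod.fst atTop) (nhds a₀))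
    (hb : Tendsto (fun q : ℕ × ℕ => b q.2 q.1) (comap Prod.fst atTop) (nhds b₀))
    (f : C(ℝ, ℝ)) :
    Tendsto (fun q : ℕ × ℕ => ((q.1 : ℝ) + 1)⁻¹ *
      ∑ l ∈ Finset.range (q.1 + 1), (h q.2).functional l f)
      (comap Prod.fst atTop) (nhds (arcsineFunctional a₀ b₀ f)) := by
  have hA₁ : R ≤ max R (|a₀| + 2 * |b₀|) := le_max_left _ _
  have hlim := tendsto_of_tendsto_pow (F := comap Prod.fst atTop)
    (A := max R (|a₀| + 2 * |b₀|))
    (Φ := fun q : ℕ × ℕ => (h q.2).functional q.1) (Ψ := arcsineFunctional a₀ b₀)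
    (fun q f ε hf => (h q.2).abs_functional_le q.1 fun x hx => hf x (hx.trans hA₁))
    (abs_arcsineFunctional_le (le_max_right _ _))
    (fun m => by
      have h1 := tendsto_moment h ha hb m 0
      simp only [add_zero, Int.toNat_natCast] at h1
      simp only [functional_pow]
      convert h1 using 2
      simp [arcsineFunctional_apply, arcsineMoment]) f
  obtain ⟨C, hC⟩ := (isCompact_Icc (a := -R) (b := R)).exists_bound_of_continuousOn
    f.continuous.continuousOn
  exact tendsto_uniform_cesaro (U := fun q => (h q.2).functional q.1 f) hlim (B := C) fun q =>
    (h q.2).abs_functional_le q.1 fun x hx => hC x (abs_le.1 hx)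

/-- The normalized counting functional of finitely many points. -/
noncomputable def countingFunctional {n : ℕ} (y : Fin (n + 1) → ℝ) : C(ℝ, ℝ) →ₗ[ℝ] ℝ where
  toFun f := ((n : ℝ) + 1)⁻¹ * ∑ j, f (y j)
  map_add' f g := by simp [Finset.sum_add_distrib, mul_add]
  map_smul' r f := by
    simp only [ContinuousMap.smul_apply, smul_eq_mul, RingHom.id_apply, ← Finset.mul_sum]
    ring

lemma countingFunctional_apply {n : ℕ} (y : Fin (n + 1) → ℝ) (f : C(ℝ, ℝ)) :
    countingFunctional y f = ((n : ℝ) + 1)⁻¹ * ∑ j, f (y j) := rfl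

lemma tendsto_root_average (h : ∀ k, IsJacobiSystem R (μ k) (p k) (a k) (b k))
    (ha : Tendsto (fun q : ℕ × ℕ => a q.2 q.1) (comap Prod.fst atTop) (nhds a₀))
    (hb : Tendsto (fun q : ℕ × ℕ => b q.2 q.1) (comap Prod.fst atTop) (nhds b₀))
    (y : ∀ q : ℕ × ℕ, Fin (q.1 + 1) → ℝ) (hy : ∀ q, Function.Injective (y q))
    (hroot : ∀ (q : ℕ × ℕ) j, (p q.2 (q.1 + 1)).eval (y q j) = 0) (f : C(ℝ, ℝ)) :
    Tendsto (fun q : ℕ × ℕ => ((q.1 : ℝ) + 1)⁻¹ * ∑ j, f (y q j))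
      (comap Prod.fst atTop) (nhds (arcsineFunctional a₀ b₀ f)) := by
  have hA₁ : 3 * R ≤ max (3 * R) (|a₀| + 2 * |b₀|) := le_max_left _ _
  refine tendsto_of_tendsto_pow (A := max (3 * R) (|a₀| + 2 * |b₀|))
    (Φ := fun q : ℕ × ℕ => countingFunctional (y q)) (Ψ := arcsineFunctional a₀ b₀)
    (fun q f ε hf => ?_) (abs_arcsineFunctional_le (le_max_right _ _)) (fun m => ?_) f
  · rw [countingFunctional_apply, abs_mul, abs_of_nonneg (by positivity),
      inv_mul_le_iff₀ (by positivity)]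
    refine (Finset.abs_sum_le_sum_abs _ _).trans ?_
    refine (Finset.sum_le_card_nsmul _ _ ε fun j _ =>
      hf _ (((h q.2).abs_root_le (hroot q j)).trans hA₁)).trans ?_
    simp
  · have h1 := tendsto_functional_average h ha hb (ContinuousMap.id ℝ ^ m)
    refine tendsto_of_tendsto_of_dist h1 ?_
    have h2 : Tendsto (fun q : ℕ × ℕ => (m * (2 * (3 * R) ^ m)) * (1 / ((q.1 : ℝ) + 1)))
        (comap Prod.fst atTop) (nhds 0) := by
      have h3 := (tendsto_one_div_add_atTop_nhds_zero_nat (𝕜 := ℝ)).comp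
        (tendsto_comap (f := (Prod.fst : ℕ × ℕ → ℕ)) (x := atTop))
      simpa [Function.comp_def] using h3.const_mul (m * (2 * (3 * R) ^ m))
    refine squeeze_zero (fun _ => dist_nonneg) (fun q => ?_) h2
    have h3 := (h q.2).abs_sum_root_pow_sub_le (hy q) (hroot q) m
    rw [dist_comm, Real.dist_eq, countingFunctional_apply, ← mul_sub, abs_mul,
      abs_of_nonneg (by positivity), mul_comm, ← one_div]
    refine mul_le_mul_of_nonneg_right ?_ (by positivity)
    simpa only [functional_pow, ContinuousMap.pow_apply, ContinuousMap.id_apply] using h3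

end Family

lemma sum_range_mul_add_one (s : ℕ → ℝ) (n : ℕ) :
    ∑ k ∈ Finset.range (n + 1), s (n - k) * ((k : ℝ) + 1)
      = ∑ k ∈ Finset.range (n + 1), ∑ j ∈ Finset.range (k + 1), s j := by
  induction n with
  | zero => simp
  | succ n ih =>
    rw [Finset.sum_range_succ (fun k => ∑ j ∈ Finset.range (k + 1), s j), ← ih,
      Finset.sum_range_succ']
    have h1 : ∑ j ∈ Finset.range (n + 1 + 1), s j
        = ∑ k ∈ Finset.range (n + 1), s (n - k) + s (n + 1) := by
      rw [Finset.sum_range_succ, ← Finset.sum_range_reflect]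
      simp
    rw [h1, ← add_assoc, ← Finset.sum_add_distrib]
    simp only [Nat.add_sub_add_right, Nat.sub_zero, Nat.cast_zero, zero_add, mul_one]
    congr 1
    refine Finset.sum_congr rfl fun k _ => ?_
    push_cast
    ring

lemma tendsto_noerlund_average {T : ℕ × ℕ → ℝ} {c B : ℝ}
    (hT : Tendsto (fun q : ℕ × ℕ => ((q.1 : ℝ) + 1)⁻¹ * T q) (comap Prod.fst atTop) (nhds c))
    (hB : ∀ q, |T q| ≤ B * ((q.1 : ℝ) + 1)) {σ : ℕ → ℕ → ℝ} {N : ℕ → ℝ}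
    (hσ₀ : ∀ n k, k ≤ n → 0 ≤ σ n k)
    (hσ : ∀ k, Tendsto (fun n => σ n k) atTop (nhds 0))
    (hσN : ∀ n, ∑ k ∈ Finset.range (n + 1), σ n k * ((k : ℝ) + 1) = N n)
    (hN : Tendsto N atTop atTop) :
    Tendsto (fun n => (1 / N n) * ∑ k ∈ Finset.range (n + 1), σ n k * T (k, n - k)) atTop
      (nhds c) := by
  have h := tendsto_regular_average (F := atTop) hT (B := B) (fun q => by
      rw [abs_mul, abs_of_nonneg (by positivity), inv_mul_le_iff₀ (by positivity), mul_comm]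
      exact hB q)
    (w := fun n k => (1 / N n) * (σ n k * ((k : ℝ) + 1))) (ν := fun n => n + 1)
    (by
      filter_upwards [hN.eventually_ge_atTop 0] with n hn k hk
      have := hσ₀ n k (by simpa [Nat.lt_succ_iff] using hk)
      positivity)
    (by
      filter_upwards [hN.eventually_gt_atTop 0] with n hn
      rw [← Finset.mul_sum, hσN, one_div, inv_mul_cancel₀ hn.ne'])
    (fun k => by
      have h1 : Tendsto (fun n => 1 / N n) atTop (nhds 0) := by
        simp only [one_div]
        exact hN.inv_tendsto_atTop
      simpa using h1.mul ((hσ k).mul_const ((k : ℝ) + 1)))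
    (fun n k => n - k)
  refine h.congr fun n => ?_
  rw [Finset.mul_sum]
  refine Finset.sum_congr rfl fun k _ => ?_
  have : (k : ℝ) + 1 ≠ 0 := by positivity
  field_simp

theorem stmt8
    (μ : ℕ → MeasureTheory.Measure ℝ)
    (hfin : ∀ k, MeasureTheory.IsFiniteMeasure (μ k))
    (hsupp : ∃ R : ℝ, ∀ k, μ k ((Set.Icc (-R) R)ᶜ) = 0)
    (p : ℕ → ℕ → Polynomial ℝ) (ca cb : ℕ → ℕ → ℝ)
    (hdeg : ∀ k l, (p k l).natDegree = l)
    (hlead : ∀ k l, 0 < (p k l).leadingCoeff)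
    (horth : ∀ k l m, (∫ x, (p k l).eval x * (p k m).eval x ∂ (μ k)) = if l = m then 1 else 0)
    (hb0 : ∀ k, cb k 0 = 0)
    (hbpos : ∀ k l, 0 < cb k (l+1))
    (hrec : ∀ k l, Polynomial.X * p k l =
      Polynomial.C (cb k (l+1)) * p k (l+1) + Polynomial.C (ca k l) * p k l +
      Polynomial.C (cb k l) * p k (l-1))
    (xr : ℕ → ℕ → ℕ → ℝ)
    (hroot : ∀ k n j, 1 ≤ j → j ≤ n+1 → (p k (n+1)).eval (xr k (n+1) j) = 0)
    (hrootlt : ∀ k n i j, 1 ≤ i → i < j → j ≤ n+1 → xr k (n+1) i < xr k (n+1) j)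
    (σ : ℕ → ℕ → ℝ)
    (hσ0 : ∀ n k, k ≤ n → 0 ≤ σ n k)
    (hσ1 : ∀ n, ∑ k ∈ Finset.range (n+1), σ n k = 1)
    (hσ2 : ∀ k, Filter.Tendsto (fun n => σ n k) Filter.atTop (nhds 0))
    (σs : ℕ → ℝ) (hσs : ∀ j, 0 ≤ σs j)
    (τ : ℕ → ℝ) (hτ : ∀ n, τ n = (∑ j ∈ Finset.range (n+1), σs j)⁻¹)
    (hτpos : ∀ n, 0 < τ n)
    (hfac : ∀ n k, k ≤ n → σ n k = τ n * σs (n-k))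
    (N : ℕ → ℝ) (hN : ∀ n, N n = τ n * ∑ k ∈ Finset.range (n+1), (τ k)⁻¹)
    (hNinf : Filter.Tendsto N Filter.atTop Filter.atTop)
    (a₀ b₀ : ℝ) (hb₀ : 0 < b₀)
    (hUa : ∀ ε : ℝ, 0 < ε → ∃ N₀ : ℕ, ∀ n, N₀ ≤ n → ∀ k, |ca k n - a₀| ≤ ε)
    (hUb : ∀ ε : ℝ, 0 < ε → ∃ N₀ : ℕ, ∀ n, N₀ ≤ n → ∀ k, |cb k n - b₀| ≤ ε)
    :
    ∀ f : ℝ → ℝ, Continuous f → (∃ C : ℝ, ∀ x, |f x| ≤ C) →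
      (Filter.Tendsto (fun n => (1 / N n) * ∑ k ∈ Finset.range (n+1),
          σ n k * ∫ x, f x * (∑ l ∈ Finset.range (k+1), ((p (n-k) l).eval x)^2) ∂ (μ (n-k)))
          Filter.atTop
        (nhds ((1 / Real.pi) * ∫ x in (a₀ - 2*b₀)..(a₀ + 2*b₀),
          f x / Real.sqrt (4*b₀^2 - (x - a₀)^2)))) ∧
      (Filter.Tendsto (fun n => (1 / N n) * ∑ k ∈ Finset.range (n+1),
          σ n k * ∑ j ∈ Finset.Icc 1 (k+1), f (xr (n-k) (k+1) j))
          Filter.atTop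
        (nhds ((1 / Real.pi) * ∫ x in (a₀ - 2*b₀)..(a₀ + 2*b₀),
          f x / Real.sqrt (4*b₀^2 - (x - a₀)^2)))) := by
  intro f hf hfC
  obtain ⟨C, hC⟩ := hfC
  obtain ⟨R, hR⟩ := hsupp
  have hsys : ∀ k, IsJacobiSystem R (μ k) (p k) (ca k) (cb k) := fun k =>
    { finite := hfin k
      supp := by
        have : ∀ᵐ x ∂μ k, x ∈ Set.Icc (-R) R := hR k
        filter_upwards [this] with x hx
        exact abs_le.2 hx
      natDegree := hdeg k
      orth := horth k
      zero := hb0 k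
      recurrence := fun l x => by
        simpa using congrArg (Polynomial.eval x) (hrec k l) }
  have hunif : ∀ (u : ℕ → ℕ → ℝ) (u₀ : ℝ),
      (∀ ε : ℝ, 0 < ε → ∃ N₀ : ℕ, ∀ n, N₀ ≤ n → ∀ k, |u k n - u₀| ≤ ε) →
      Tendsto (fun q : ℕ × ℕ => u q.2 q.1) (comap Prod.fst atTop) (nhds u₀) := by
    intro u u₀ hu
    rw [Metric.tendsto_nhds]
    intro ε hε
    obtain ⟨N₀, hN₀⟩ := hu (ε / 2) (half_pos hε)
    filter_upwards [tendsto_comap.eventually (eventually_ge_atTop N₀)] with q hq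
    rw [Real.dist_eq]
    linarith [hN₀ q.1 hq q.2]
  have ha := hunif ca a₀ hUa
  have hb := hunif cb b₀ hUb
  have hσN : ∀ n, ∑ k ∈ Finset.range (n + 1), σ n k * ((k : ℝ) + 1) = N n := by
    intro n
    simp only [hN, hτ, inv_inv]
    rw [← hτ, ← sum_range_mul_add_one, Finset.mul_sum]
    refine Finset.sum_congr rfl fun k hk => ?_
    rw [hfac n k (by simpa [Nat.lt_succ_iff] using hk), mul_assoc]
  let F : C(ℝ, ℝ) := ⟨f, hf⟩
  have hlim := arcsineFunctional_eq_integral (a := a₀) hb₀ F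
  simp only [F, ContinuousMap.coe_mk] at hlim
  rw [← hlim]
  constructor
  · have h1 := tendsto_noerlund_average (B := C) (tendsto_functional_average hsys ha hb F)
      (fun q => by
        refine (Finset.abs_sum_le_sum_abs _ _).trans ?_
        refine (Finset.sum_le_card_nsmul _ _ C fun l _ =>
          (hsys q.2).abs_functional_le l fun x _ => hC x).trans ?_
        simp [mul_comm]) hσ0 hσ2 hσN hNinf
    refine h1.congr fun n => ?_
    congr 1
    refine Finset.sum_congr rfl fun k _ => ?_
    simp only [Finset.mul_sum]
    rw [integral_finsetSum _ fun l _ => (hsys (n - k)).integrable (by fun_prop)]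
    simp only [IsJacobiSystem.functional_apply, F, ContinuousMap.coe_mk, Finset.mul_sum]
  · let y : ∀ q : ℕ × ℕ, Fin (q.1 + 1) → ℝ := fun q j => xr q.2 (q.1 + 1) (j + 1)
    have hy : ∀ q, StrictMono (y q) := fun q i j hij =>
      hrootlt q.2 q.1 (i + 1) (j + 1) (by omega) (by simpa using hij) (by omega)
    have h1 := tendsto_noerlund_average (B := C)
      (tendsto_root_average hsys ha hb y (fun q => (hy q).injective)
        (fun q j => hroot q.2 q.1 (j + 1) (by omega) (by omega)) F)
      (fun q => by
        refine (Finset.abs_sum_le_sum_abs _ _).trans ?_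
        refine (Finset.sum_le_card_nsmul _ _ C fun j _ => hC _).trans ?_
        simp [mul_comm]) hσ0 hσ2 hσN hNinf
    refine h1.congr fun n => ?_
    congr 1
    refine Finset.sum_congr rfl fun k _ => ?_
    congr 1
    rw [← Finset.Ico_add_one_right_eq_Icc, Finset.sum_Ico_eq_sum_range, Finset.sum_range]
    simp [y, F, add_comm]
end

section
/- Let λ > 0 and, for s > −1/2, set m^(s) = ∫_{−1}^1 (1−x²)^{s−1/2} dx. For each integer q ≥ 0 define the orthonormal ultraspherical polynomials p_j^(q,λ) by p_{−1}^(q,λ) = 0, p_0^(q,λ) = (m^(q+λ))^{−1/2}, and the recurrence x p_j^(q,λ)(x) = b_{j+1}^(q,λ) p_{j+1}^(q,λ)(x) + b_j^(q,λ) p_{j−1}^(q,λ)(x), where b_j^(q,λ) = (1/2)√( j(j + 2q + 2λ − 1) / ( (j+q+λ−1)(j+q+λ) ) ). Then for every n ∈ ℕ and every x ∈ [−1,1], Σ_{k=0}^n σ_{n,k}^(G,λ) (1−x²)^{n−k} ( p_k^(n−k,λ)(x) )² = 1 / m^(λ), where σ_{n,k}^(G,λ) are the Gegenbauer summation weights.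 -/
open Filter MeasureTheory

/-- Gegenbauer functions `C_{k-1}^μ(x)`, with the degree shifted by one so that index `0` is the
zero function. -/
noncomputable def gegen (μ x : ℝ) : ℕ → ℝ
  | 0 => 0
  | 1 => 1
  | (k + 2) => (2 * (k + μ) * x * gegen μ x (k + 1) - (k + 2 * μ - 1) * gegen μ x k) / (k + 1)

/-- The squared factor turning Gegenbauer polynomials into orthonormal ones, where `M` is the
total mass of the weight. -/
noncomputable def gegenNormSq (μ M : ℝ) : ℕ → ℝ
  | 0 => 1 / M
  | (k + 1) => gegenNormSq μ M k * ((k + 1) * (k + 1 + μ) / ((k + μ) * (k + 2 * μ)))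

theorem gegen_rec (μ x : ℝ) (k : ℕ) :
    (k + 1) * gegen μ x (k + 2) =
      2 * (k + μ) * x * gegen μ x (k + 1) - (k + 2 * μ - 1) * gegen μ x k := by
  have h : (k : ℝ) + 1 ≠ 0 := by positivity
  rw [gegen]
  field_simp

theorem gegen_contiguous (μ x : ℝ) (k : ℕ) :
    (k + 2 * μ) * gegen μ x (k + 1) =
        2 * μ * (gegen (μ + 1) x (k + 1) - x * gegen (μ + 1) x k) ∧
      (k + 1) * gegen μ x (k + 2) =
        2 * μ * (x * gegen (μ + 1) x (k + 1) - gegen (μ + 1) x k) := by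
  induction k with
  | zero => simp [gegen]
  | succ k ih =>
    obtain ⟨h1, h2⟩ := ih
    have hE := gegen_rec (μ + 1) x k
    have hC := gegen_rec μ x (k + 1)
    have hk : (k : ℝ) + 1 ≠ 0 := by positivity
    push_cast at hC ⊢
    have h3 : ((k : ℝ) + 1 + 2 * μ) * gegen μ x (k + 1 + 1) =
        2 * μ * (gegen (μ + 1) x (k + 1 + 1) - x * gegen (μ + 1) x (k + 1)) := by
      apply mul_left_cancel₀ hk
      linear_combination (k + 1 + 2 * μ) * h2 - 2 * μ * hE
    refine ⟨h3, ?_⟩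
    linear_combination hC + x * h3 + x * h2 - h1

theorem gegen_ode (μ x : ℝ) (k : ℕ) :
    (1 - x ^ 2) * (4 * μ * (μ + 1)) * gegen (μ + 2) x k +
        (k + 1) * (k + 1 + 2 * μ) * gegen μ x (k + 2) =
      (2 * μ + 1) * (2 * μ) * x * gegen (μ + 1) x (k + 1) := by
  have h := (gegen_contiguous μ x k).2
  cases k with
  | zero => simp [gegen]; ring
  | succ k =>
    obtain ⟨h1, h2⟩ := gegen_contiguous (μ + 1) x k
    rw [add_assoc μ 1 1, one_add_one_eq_two] at h1 h2
    push_cast at h ⊢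
    linear_combination (k + 2 + 2 * μ) * h + 2 * μ * x * h2 - 2 * μ * h1

theorem hasDerivAt_gegen (μ x : ℝ) (k : ℕ) :
    HasDerivAt (fun y => gegen μ y (k + 1)) (2 * μ * gegen (μ + 1) x k) x := by
  induction k using Nat.strong_induction_on with
  | _ k ih =>
    match k with
    | 0 => simpa [gegen] using hasDerivAt_const x (1 : ℝ)
    | 1 => simpa [gegen] using (hasDerivAt_id x).const_mul (2 * μ)
    | k + 2 =>
      have d1 := ih (k + 1) (by omega)
      have d0 := ih k (by omega)
      have hk : ((k + 1 : ℕ) : ℝ) + 1 ≠ 0 := by positivity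
      have e : (fun y => gegen μ y (k + 2 + 1)) = fun y =>
          (2 * ((k + 1 : ℕ) + μ) * y * gegen μ y (k + 1 + 1)
            - ((k + 1 : ℕ) + 2 * μ - 1) * gegen μ y (k + 1)) / ((k + 1 : ℕ) + 1) := by
        funext y
        rw [gegen]
      rw [e]
      have d := ((((hasDerivAt_id x).const_mul (2 * ((k + 1 : ℕ) + μ))).mul d1).sub
        (d0.const_mul ((k + 1 : ℕ) + 2 * μ - 1))).div_const (((k + 1 : ℕ) : ℝ) + 1)
      refine d.congr_deriv ?_
      rw [div_eq_iff hk]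
      obtain ⟨h1, h2⟩ := gegen_contiguous μ x k
      have h3 := (gegen_contiguous μ x (k + 1)).1
      have hE := gegen_rec (μ + 1) x k
      simp only [id]
      push_cast at h3 ⊢
      linear_combination h3 + h2 - 2 * μ * hE

theorem gegen_one_succ (μ : ℝ) (k : ℕ) :
    (k + 1) * gegen μ 1 (k + 2) = (k + 2 * μ) * gegen μ 1 (k + 1) := by
  induction k with
  | zero => simp [gegen]
  | succ k ih =>
    have h := gegen_rec μ 1 (k + 1)
    push_cast at h ⊢
    linear_combination h + ih

theorem gegenNormSq_nonneg {μ M : ℝ} (hμ : 0 < μ) (hM : 0 < M) (k : ℕ) :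
    0 ≤ gegenNormSq μ M k := by
  induction k with
  | zero => rw [gegenNormSq]; positivity
  | succ k ih => rw [gegenNormSq]; positivity

theorem gegenNormSq_shift {μ M M' : ℝ} (hμ : 0 < μ) (hM : 0 < M) (hM' : 0 < M')
    (h : M' * (μ + 1) = M * (μ + 1 / 2)) (k : ℕ) :
    (k + 1) * (2 * μ + k + 1) * gegenNormSq (μ + 1) M' k =
      4 * μ ^ 2 * gegenNormSq μ M (k + 1) := by
  induction k with
  | zero =>
    simp only [gegenNormSq]
    push_cast
    field_simp
    linear_combination (-4 * μ ^ 2) * h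
  | succ k ih =>
    have e : gegenNormSq (μ + 1) M' k =
        4 * μ ^ 2 * gegenNormSq μ M (k + 1) / ((k + 1) * (2 * μ + k + 1)) := by
      rw [← ih]; field_simp
    rw [gegenNormSq, e, gegenNormSq.eq_2 μ M (k + 1)]
    push_cast
    have a1 : (k : ℝ) + (μ + 1) ≠ 0 := by positivity
    have a2 : (k : ℝ) + 2 * (μ + 1) ≠ 0 := by positivity
    have a3 : (k : ℝ) + 1 + μ ≠ 0 := by positivity
    have a4 : (k : ℝ) + 1 + 2 * μ ≠ 0 := by positivity
    have a5 : 2 * μ + (k : ℝ) + 1 ≠ 0 := by positivity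
    field_simp
    ring

theorem eq_sqrt_gegenNormSq_mul_gegen {μ M x : ℝ} (hμ : 0 < μ) (hM : 0 < M) (b P : ℕ → ℝ)
    (hb0 : b 0 = 0)
    (hb : ∀ k : ℕ, b (k + 1) =
      1 / 2 * √(((k + 1) * (k + 2 * μ)) / ((k + μ) * (k + 1 + μ))))
    (hP0 : P 0 = 1 / √M)
    (hP : ∀ k : ℕ, x * P k = b (k + 1) * P (k + 1) + b k * P (k - 1)) (k : ℕ) :
    P k = √(gegenNormSq μ M k) * gegen μ x (k + 1) := by
  have hbpos : ∀ k, 0 < b (k + 1) := fun k => by rw [hb]; positivity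
  have up : ∀ k : ℕ, b (k + 1) * √(gegenNormSq μ M (k + 1)) =
      √(gegenNormSq μ M k) * ((k + 1) / (2 * (k + μ))) := fun k => by
    have h0 := gegenNormSq_nonneg hμ hM k
    rw [hb, mul_assoc, ← Real.sqrt_mul (by positivity)]
    have e : ((k : ℝ) + 1) * (k + 2 * μ) / ((k + μ) * (k + 1 + μ)) * gegenNormSq μ M (k + 1) =
        gegenNormSq μ M k * ((k + 1) / (k + μ)) ^ 2 := by
      rw [gegenNormSq]; field_simp
    rw [e, Real.sqrt_mul h0, Real.sqrt_sq (by positivity)]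
    field_simp
  have down : ∀ k : ℕ, b (k + 1) * √(gegenNormSq μ M k) =
      √(gegenNormSq μ M (k + 1)) * ((k + 2 * μ) / (2 * (k + 1 + μ))) := fun k => by
    have h0 := gegenNormSq_nonneg hμ hM (k + 1)
    rw [hb, mul_assoc, ← Real.sqrt_mul (by positivity)]
    have e : ((k : ℝ) + 1) * (k + 2 * μ) / ((k + μ) * (k + 1 + μ)) * gegenNormSq μ M k =
        gegenNormSq μ M (k + 1) * ((k + 2 * μ) / (k + 1 + μ)) ^ 2 := by
      rw [gegenNormSq]; field_simp
    rw [e, Real.sqrt_mul h0, Real.sqrt_sq (by positivity)]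
    field_simp
  induction k using Nat.strong_induction_on with
  | _ k ih =>
    match k with
    | 0 => simp [hP0, gegen, gegenNormSq]
    | 1 =>
      have h := hP 0
      have i0 := ih 0 (by omega)
      have u := up 0
      apply mul_left_cancel₀ (hbpos 0).ne'
      rw [← mul_assoc, u]
      rw [hb0, i0] at h
      simp only [gegen, zero_add] at h ⊢
      push_cast
      field_simp
      linear_combination (-2 * μ) * h
    | k + 2 =>
      have h := hP (k + 1)
      have i1 := ih (k + 1) (by omega)
      have i0 := ih k (by omega)
      have u := up (k + 1)
      have d := down k
      have r := gegen_rec μ x (k + 1)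
      apply mul_left_cancel₀ (hbpos (k + 1)).ne'
      rw [← mul_assoc, u]
      rw [Nat.add_sub_cancel, i1, i0, ← mul_assoc (b (k + 1)), d] at h
      push_cast at r ⊢
      have hk : (k : ℝ) + 1 + μ ≠ 0 := by positivity
      field_simp at h ⊢
      linear_combination (-1) * h - √(gegenNormSq μ M (k + 1)) * r

theorem intervalIntegrable_one_sub_sq_rpow {r : ℝ} (hr : -1 < r) :
    IntervalIntegrable (fun x : ℝ => (1 - x ^ 2) ^ r) volume (-1) 1 := by
  have h1 : IntervalIntegrable (fun x : ℝ => (1 - x ^ 2) ^ r) volume 0 1 := by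
    have a : IntervalIntegrable (fun x : ℝ => (1 - x) ^ r) volume 0 1 := by
      simpa using ((intervalIntegral.intervalIntegrable_rpow' (a := 0) (b := 1) hr).comp_sub_left
        1).symm
    have c : ContinuousOn (fun x : ℝ => (1 + x) ^ r) (Set.uIcc 0 1) := by
      rw [Set.uIcc_of_le zero_le_one]
      exact ContinuousOn.rpow_const (by fun_prop) fun x hx => Or.inl (by linarith [hx.1])
    refine (a.mul_continuousOn c).congr fun x hx => ?_
    rw [Set.uIoc_of_le zero_le_one] at hx
    rw [← Real.mul_rpow (by linarith [hx.2]) (by linarith [hx.1])]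
    ring_nf
  have h2 : IntervalIntegrable (fun x : ℝ => (1 - x ^ 2) ^ r) volume (-1) 0 := by
    have := (IntervalIntegrable.iff_comp_neg (f := fun x : ℝ => (1 - x ^ 2) ^ r)
      (a := 0) (b := 1)).1 h1
    simpa using this.symm
  exact h2.trans h1

theorem integral_one_sub_sq_rpow_pos {s : ℝ} (hs : 0 < s) :
    0 < ∫ x in (-1 : ℝ)..1, (1 - x ^ 2) ^ (s - 1 / 2) :=
  intervalIntegral.intervalIntegral_pos_of_pos_on
    (intervalIntegrable_one_sub_sq_rpow (by linarith))
    (fun x hx => Real.rpow_pos_of_pos (by nlinarith [hx.1, hx.2]) _) (by norm_num)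

theorem integral_one_sub_sq_rpow_succ {s : ℝ} (hs : 0 < s) :
    (∫ x in (-1 : ℝ)..1, (1 - x ^ 2) ^ (s + 1 - 1 / 2)) * (s + 1) =
      (∫ x in (-1 : ℝ)..1, (1 - x ^ 2) ^ (s - 1 / 2)) * (s + 1 / 2) := by
  have i1 := intervalIntegrable_one_sub_sq_rpow (r := s + 1 - 1 / 2) (by linarith)
  have i0 := intervalIntegrable_one_sub_sq_rpow (r := s - 1 / 2) (by linarith)
  have key := intervalIntegral.integral_eq_sub_of_hasDerivAt_of_le (a := -1) (b := 1)
    (f := fun x : ℝ => x * (1 - x ^ 2) ^ (s + 1 - 1 / 2))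
    (f' := fun x : ℝ => (2 * s + 2) * (1 - x ^ 2) ^ (s + 1 - 1 / 2)
      - (2 * s + 1) * (1 - x ^ 2) ^ (s - 1 / 2)) (by norm_num)
    (ContinuousOn.mul (by fun_prop)
      (ContinuousOn.rpow_const (by fun_prop) fun x _ => Or.inr (by linarith)))
    (fun x hx => by
      have hx0 : 0 < 1 - x ^ 2 := by nlinarith [hx.1, hx.2]
      have d := (hasDerivAt_id x).mul ((((hasDerivAt_id x).pow 2).const_sub 1).rpow_const
        (p := s + 1 - 1 / 2) (Or.inl (by simpa using hx0.ne')))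
      refine d.congr_deriv ?_
      have e : (1 - x ^ 2) ^ (s + 1 - 1 / 2) = (1 - x ^ 2) ^ (s - 1 / 2) * (1 - x ^ 2) := by
        rw [← Real.rpow_add_one hx0.ne']; ring_nf
      have e' : s + 1 - 1 / 2 - 1 = s - 1 / 2 := by ring
      simp only [id, Pi.pow_apply, e, e']
      push_cast
      ring)
    ((i1.const_mul _).sub (i0.const_mul _))
  rw [intervalIntegral.integral_sub (i1.const_mul _) (i0.const_mul _),
    intervalIntegral.integral_const_mul, intervalIntegral.integral_const_mul] at key
  have z : (0 : ℝ) ^ (s + 1 - 1 / 2) = 0 := Real.zero_rpow (by linarith)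
  norm_num at key z
  norm_num
  rw [z] at key
  linarith

/-- The derivative of the partial sums telescopes. -/
theorem hasDerivAt_sum_gegen_sq {lam τ : ℝ} (hlam : 0 < lam) (m σ : ℕ → ℝ)
    (hm : ∀ q, 0 < m q) (hm1 : ∀ q : ℕ, m (q + 1) * (q + lam + 1) = m q * (q + lam + 1 / 2))
    (hσ0 : σ 0 = 1) (hσ1 : σ 1 = 2 * lam + 1)
    (hσ : ∀ q : ℕ, (q + 2) * (2 * q + 2 * lam + 1) * σ (q + 2) =
      (2 * q + 2 * lam + 3) * (q + 2 * lam) * σ (q + 1)) (x : ℝ) (n N : ℕ) (hN : N ≤ n) :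
    HasDerivAt (fun y => ∑ q ∈ Finset.range (N + 1),
        τ * σ q * (1 - y ^ 2) ^ q * (gegenNormSq (q + lam) (m q) (n - q) *
          gegen (q + lam) y (n - q + 1) ^ 2))
      (4 * (N + lam) * (N + 1) / (2 * (N + lam) + 1) * τ * σ (N + 1) *
        gegenNormSq (N + lam) (m N) (n - N) * ((1 - x ^ 2) ^ N * gegen (N + lam) x (n - N + 1) *
          gegen (N + lam + 1) x (n - N))) x := by
  induction N with
  | zero =>
    simp only [zero_add, Finset.sum_range_one]
    have d := (((hasDerivAt_gegen lam x n).pow 2).const_mul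
      (gegenNormSq lam (m 0) n)).const_mul τ
    simp only [CharP.cast_eq_zero, zero_add, hσ0, hσ1, Nat.sub_zero, pow_zero, mul_one]
    refine d.congr_deriv ?_
    have : 2 * lam + 1 ≠ 0 := by positivity
    push_cast
    field_simp
    ring
  | succ N ih =>
    obtain ⟨k, rfl⟩ : ∃ k, n = N + 1 + k := ⟨n - (N + 1), by omega⟩
    have ih := ih (by omega)
    have e1 : N + 1 + k - N = k + 1 := by omega
    have e2 : N + 1 + k - (N + 1) = k := by omega
    have e3 : ((N + 1 : ℕ) : ℝ) + lam = N + lam + 1 := by push_cast; ring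
    simp only [Finset.sum_range_succ _ (N + 1)]
    rw [e1] at ih
    rw [e2, e3]
    have dw := (((hasDerivAt_id x).pow 2).const_sub 1).pow (N + 1)
    have d := ih.add ((dw.const_mul (τ * σ (N + 1))).mul
      (((hasDerivAt_gegen (N + lam + 1) x k).pow 2).const_mul
        (gegenNormSq (N + lam + 1) (m (N + 1)) k)))
    refine d.congr_deriv ?_
    have hs := gegenNormSq_shift (μ := N + lam) (by positivity) (hm N) (hm (N + 1)) (hm1 N) k
    have ho := gegen_ode (N + lam) x k
    have hσN := hσ N
    rw [show (N : ℝ) + lam + 1 + 1 = N + lam + 2 by ring]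
    have eS : gegenNormSq (N + lam) (m N) (k + 1) = (k + 1) * (2 * (N + lam) + k + 1) *
        gegenNormSq (N + lam + 1) (m (N + 1)) k / (4 * (N + lam) ^ 2) := by
      rw [hs]
      have : (N : ℝ) + lam ≠ 0 := by positivity
      field_simp
    have eσ : σ (N + 1 + 1) = (2 * N + 2 * lam + 3) * (N + 2 * lam) * σ (N + 1) /
        ((N + 2) * (2 * N + 2 * lam + 1)) := by
      rw [← hσN]; field_simp
    rw [eS, eσ]
    have h0 : (N : ℝ) + lam ≠ 0 := by positivity
    have h1 : 2 * ((N : ℝ) + lam) + 1 ≠ 0 := by positivity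
    have h2 : 2 * ((N : ℝ) + lam + 1) + 1 ≠ 0 := by positivity
    have h3 : 2 * (N : ℝ) + 2 * lam + 1 ≠ 0 := by positivity
    simp only [id, Pi.pow_apply, Nat.add_sub_cancel]
    push_cast
    generalize gegenNormSq (N + lam + 1) (m (N + 1)) k = S
    generalize gegen (N + lam + 1) x (k + 1) = E at *
    generalize gegen (N + lam + 2) x k = H at *
    have eC : gegen (N + lam) x (k + 1 + 1) = ((2 * (N + lam) + 1) * (2 * (N + lam)) * x * E -
        (1 - x ^ 2) * (4 * (N + lam) * (N + lam + 1)) * H) / ((k + 1) * (k + 1 + 2 * (N + lam))) := by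
      rw [← ho]
      field_simp
      ring
    rw [eC]
    have h4 : (k : ℝ) + 1 + 2 * (N + lam) ≠ 0 := by positivity
    have h5 : 2 * ((N : ℝ) + lam) + k + 1 ≠ 0 := by positivity
    rw [pow_succ (1 - x ^ 2)]
    generalize (1 - x ^ 2) ^ N = W
    field_simp
    ring

theorem gegen_one_sq_mul_gegenNormSq {lam M : ℝ} (hlam : 0 < lam) (n : ℕ) :
    Real.Gamma (2 * lam + 1) * Real.Gamma (n + 1) /
        ((2 * n + 2 * lam) * Real.Gamma (n + 2 * lam)) *
      (gegenNormSq lam M n * gegen lam 1 (n + 1) ^ 2) = 1 / M := by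
  induction n with
  | zero =>
    have h := Real.Gamma_pos_of_pos (show 0 < 2 * lam by positivity)
    simp only [gegen, gegenNormSq, CharP.cast_eq_zero, zero_add, mul_zero, Real.Gamma_one,
      Real.Gamma_add_one (show 2 * lam ≠ 0 by positivity)]
    field_simp
  | succ n ih =>
    have h := Real.Gamma_pos_of_pos (show 0 < n + 2 * lam by positivity)
    rw [← ih]
    push_cast
    rw [Real.Gamma_add_one (show (n : ℝ) + 1 ≠ 0 by positivity),
      show (n : ℝ) + 1 + 2 * lam = n + 2 * lam + 1 by ring,
      Real.Gamma_add_one (show (n : ℝ) + 2 * lam ≠ 0 by positivity), gegenNormSq]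
    have e : gegen lam 1 (n + 1 + 1) = (n + 2 * lam) * gegen lam 1 (n + 1) / (n + 1) := by
      rw [← gegen_one_succ]; field_simp
    rw [e]
    field_simp

theorem stmt14 (lam : ℝ) (hlam : 0 < lam)
    (mint : ℝ → ℝ)
    (hmint : ∀ s : ℝ, mint s = ∫ x in (-1:ℝ)..1, (1 - x^2) ^ (s - 1/2))
    (cb : ℕ → ℕ → ℝ)
    (hcb : ∀ q j : ℕ, cb q j = (1/2) * Real.sqrt
      (((j:ℝ) * ((j:ℝ) + 2*(q:ℝ) + 2*lam - 1)) /
        (((j:ℝ) + (q:ℝ) + lam - 1) * ((j:ℝ) + (q:ℝ) + lam))))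
    (p : ℕ → ℕ → Polynomial ℝ)
    (hp0 : ∀ q : ℕ, p q 0 = Polynomial.C (1 / Real.sqrt (mint ((q:ℝ) + lam))))
    (hrec : ∀ q j : ℕ, Polynomial.X * p q j =
      Polynomial.C (cb q (j+1)) * p q (j+1) + Polynomial.C (cb q j) * p q (j-1))
    (σG : ℕ → ℝ) (hσG0 : σG 0 = 1)
    (hσG : ∀ j : ℕ, 1 ≤ j → σG j =
      (2*(j:ℝ)+2*lam-1) * Real.Gamma ((j:ℝ)+2*lam-1) /
        (Real.Gamma (2*lam) * Real.Gamma ((j:ℝ)+1)))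
    (τG : ℕ → ℝ) (hτG : ∀ n : ℕ, τG n =
      Real.Gamma (2*lam+1) * Real.Gamma ((n:ℝ)+1) /
        ((2*(n:ℝ)+2*lam) * Real.Gamma ((n:ℝ)+2*lam)))
    :
    ∀ n : ℕ, ∀ x ∈ Set.Icc (-1:ℝ) 1,
      ∑ k ∈ Finset.range (n+1),
        (τG n * σG (n-k)) * (1 - x^2)^(n-k) * ((p (n-k) k).eval x)^2 = 1 / mint lam := by
  intro n x hx
  have hm : ∀ q : ℕ, 0 < mint (q + lam) := fun q => by
    rw [hmint]; exact integral_one_sub_sq_rpow_pos (by positivity)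
  have hm1 : ∀ q : ℕ, mint ((q + 1 : ℕ) + lam) * (q + lam + 1) =
      mint (q + lam) * (q + lam + 1 / 2) := fun q => by
    rw [show ((q + 1 : ℕ) : ℝ) + lam = q + lam + 1 by push_cast; ring, hmint, hmint]
    exact integral_one_sub_sq_rpow_succ (by positivity)
  have hp : ∀ q k : ℕ, ∀ y : ℝ, ((p q k).eval y) ^ 2 =
      gegenNormSq (q + lam) (mint (q + lam)) k * gegen (q + lam) y (k + 1) ^ 2 := by
    intro q k y
    have hμ : 0 < (q : ℝ) + lam := by positivity
    rw [eq_sqrt_gegenNormSq_mul_gegen hμ (hm q) (cb q) (fun k => (p q k).eval y)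
      (x := y) (by simp [hcb])
      (fun k => by
        rw [hcb]
        push_cast
        congr 3 <;> ring)
      (by simp [hp0])
      (fun k => by simpa using congrArg (Polynomial.eval y) (hrec q k)) k,
      mul_pow, Real.sq_sqrt (gegenNormSq_nonneg hμ (hm q) k)]
  have hσ1 : σG 1 = 2 * lam + 1 := by
    rw [hσG 1 le_rfl]
    have h := Real.Gamma_pos_of_pos (show 0 < 2 * lam by positivity)
    rw [show ((1 : ℕ) : ℝ) + 2 * lam - 1 = 2 * lam by push_cast; ring,
      show ((1 : ℕ) : ℝ) + 1 = 2 by push_cast; ring, Real.Gamma_two]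
    push_cast
    field_simp
    ring
  have hσ : ∀ q : ℕ, (q + 2) * (2 * q + 2 * lam + 1) * σG (q + 2) =
      (2 * q + 2 * lam + 3) * (q + 2 * lam) * σG (q + 1) := by
    intro q
    have h := Real.Gamma_pos_of_pos (show 0 < 2 * lam by positivity)
    have h' := Real.Gamma_pos_of_pos (show 0 < (q : ℝ) + 1 + 1 by positivity)
    rw [hσG _ (by omega), hσG _ (by omega)]
    push_cast
    rw [show (q : ℝ) + 2 + 2 * lam - 1 = q + 2 * lam + 1 by ring,
      show (q : ℝ) + 1 + 2 * lam - 1 = q + 2 * lam by ring,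
      show (q : ℝ) + 2 + 1 = q + 1 + 1 + 1 by ring,
      Real.Gamma_add_one (show (q : ℝ) + 2 * lam ≠ 0 by positivity),
      Real.Gamma_add_one (show (q : ℝ) + 1 + 1 ≠ 0 by positivity)]
    field_simp
    ring
  have hd := fun y => hasDerivAt_sum_gegen_sq (τ := τG n) hlam (fun q => mint (q + lam)) σG hm
    hm1 hσG0 hσ1 hσ y n n le_rfl
  simp only [Nat.sub_self, gegen, mul_zero] at hd
  have hconst := is_const_of_deriv_eq_zero (fun y => (hd y).differentiableAt)
    (fun y => (hd y).deriv) x 1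
  rw [← Finset.sum_range_reflect]
  trans ∑ q ∈ Finset.range (n + 1), τG n * σG q * (1 - x ^ 2) ^ q *
      (gegenNormSq (q + lam) (mint (q + lam)) (n - q) * gegen (q + lam) x (n - q + 1) ^ 2)
  · refine Finset.sum_congr rfl fun q hq => ?_
    have hq' : n - (n + 1 - 1 - q) = q := by
      have := Finset.mem_range.1 hq
      omega
    rw [hq', hp, Nat.add_sub_cancel]
  · refine hconst.trans ?_
    rw [Finset.sum_eq_single_of_mem 0 (by simp) fun q _ hq => by simp [hq]]
    have h := gegen_one_sq_mul_gegenNormSq (M := mint lam) hlam n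
    rw [← hτG] at h
    simpa [hσG0] using h
end
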